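/- arXiv:2101.02193 — 5 statements merged into one kernel-verified Lean document; each statement's English description precedes it below -/
import Mathlib

section
/- Let G be a CSA_Z group and let C be a nontrivial cyclic subgroup of G. Then there exists exactly one maximal abelian subgroup of G that contains C, and this subgroup is infinite cyclic. -/
/-- A subgroup is cyclic if it is generated by a single element. -/
def IsCyclicSubgroup {G : Type*} [Group G] (H : Subgroup G) : Prop :=
  ∃ c : G, H = Subgroup.zpowers c

/-- A subgroup `A ≤ G` is malnormal if `gAg⁻¹ ∩ A` is trivial for all `g ∉ A`. -/
def Malnormal {G : Type*} [Group G] (A : Subgroup G) : Prop :=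
  ∀ g : G, g ∉ A → ∀ x : G, x ∈ A → g * x * g⁻¹ ∈ A → x = 1

/-- An abelian subgroup. -/
def IsAbelianSubgroup {G : Type*} [Group G] (A : Subgroup G) : Prop :=
  ∀ x ∈ A, ∀ y ∈ A, x * y = y * x

/-- A maximal abelian subgroup: an abelian subgroup not properly contained in any
other abelian subgroup. -/
def IsMaximalAbelian {G : Type*} [Group G] (A : Subgroup G) : Prop :=
  IsAbelianSubgroup A ∧ ∀ B : Subgroup G, IsAbelianSubgroup B → A ≤ B → A = B

/-- An infinite cyclic subgroup: generated by a single element of infinite order. -/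
def IsInfiniteCyclicSubgroup {G : Type*} [Group G] (A : Subgroup G) : Prop :=
  ∃ c : G, A = Subgroup.zpowers c ∧ ¬ IsOfFinOrder c

/-- A CSA_Z group: every maximal abelian subgroup is malnormal, and every nontrivial
abelian subgroup is infinite cyclic. -/
def IsCSAZ (G : Type*) [Group G] : Prop :=
  (∀ A : Subgroup G, IsMaximalAbelian A → Malnormal A) ∧
  (∀ A : Subgroup G, IsAbelianSubgroup A → A ≠ ⊥ → IsInfiniteCyclicSubgroup A)

theorem IsAbelianSubgroup.exists_le_isMaximalAbelian {G : Type*} [Group G] {C : Subgroup G}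
    (hC : IsAbelianSubgroup C) : ∃ A : Subgroup G, IsMaximalAbelian A ∧ C ≤ A := by
  obtain ⟨A, hCA, hA⟩ := zorn_le_nonempty₀ {A : Subgroup G | IsAbelianSubgroup A}
    (fun S hS hchain B hB => by
      refine ⟨sSup S, fun x hx y hy => ?_, fun _ hz => le_sSup hz⟩
      rw [Subgroup.mem_sSup_of_directedOn ⟨B, hB⟩ hchain.directedOn] at hx hy
      obtain ⟨X, hXS, hx⟩ := hx
      obtain ⟨Y, hYS, hy⟩ := hy
      rcases hchain.total hXS hYS with h | h
      · exact hS hYS x (h hx) y hy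
      · exact hS hXS x hx y (h hy)) C hC
  exact ⟨A, ⟨hA.prop, fun _ hB hAB => hA.eq_of_le hB hAB⟩, hCA⟩

theorem Malnormal.mem_iff_commute {G : Type*} [Group G] {A : Subgroup G}
    (hA : Malnormal A) (hAb : IsAbelianSubgroup A) {c : G} (hc : c ∈ A) (hc1 : c ≠ 1) (x : G) :
    x ∈ A ↔ Commute x c := by
  refine ⟨fun hx => hAb x hx c hc, fun hx => ?_⟩
  by_contra hxA
  refine hc1 (hA x hxA c hc ?_)
  rwa [hx.eq, mul_inv_cancel_right]

/-- In a CSA_Z group, every nontrivial cyclic subgroup is contained in exactly one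
maximal abelian subgroup, and that subgroup is infinite cyclic. -/
theorem unique_maximal_abelian_of_CSAZ {G : Type*} [Group G] (hG : IsCSAZ G)
    (C : Subgroup G) (hC : IsCyclicSubgroup C) (hC1 : C ≠ ⊥) :
    (∃! A : Subgroup G, IsMaximalAbelian A ∧ C ≤ A) ∧
    (∀ A : Subgroup G, IsMaximalAbelian A → C ≤ A → IsInfiniteCyclicSubgroup A) := by
  obtain ⟨c, rfl⟩ := hC
  have hc1 : c ≠ 1 := fun h => hC1 (Subgroup.zpowers_eq_bot.mpr h)
  have habel : IsAbelianSubgroup (Subgroup.zpowers c) := by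
    rintro _ ⟨m, rfl⟩ _ ⟨n, rfl⟩
    exact zpow_mul_comm c m n
  obtain ⟨A, hA, hcA⟩ := habel.exists_le_isMaximalAbelian
  refine ⟨⟨A, ⟨hA, hcA⟩, fun B ⟨hB, hcB⟩ => Subgroup.ext fun x => ?_⟩, fun B hB hcB =>
    hG.2 B hB.1 (ne_bot_of_le_ne_bot hC1 hcB)⟩
  rw [(hG.1 A hA).mem_iff_commute hA.1 (hcA (Subgroup.mem_zpowers c)) hc1,
    (hG.1 B hB).mem_iff_commute hB.1 (hcB (Subgroup.mem_zpowers c)) hc1]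
end

section
/- For every element W of the subgroup ⟨a, b⁻¹ab⟩ of F(a,b) and every automorphism α of F(a,b), the cyclically reduced lengths satisfy |[α(W)]| ≥ |[W]|; that is, no automorphism of F(a,b) strictly decreases the minimal length of a conjugate of W. -/
/-- The free group `F(a,b)` on two generators. -/
abbrev F : Type := FreeGroup (Fin 2)

/-- The generator `a` of `F(a,b)`. -/
def a : F := FreeGroup.of 0

/-- The generator `b` of `F(a,b)`. -/
def b : F := FreeGroup.of 1

/-- The subgroup `⟨a, b⁻¹ab⟩` of `F(a,b)`. -/
def H : Subgroup F := Subgroup.closure {a, b⁻¹ * a * b}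

/-- The cyclically reduced length `|[W]|`: the minimal reduced-word length among
all conjugates of `W`. -/
noncomputable def cyclNorm (W : F) : ℕ := sInf {n : ℕ | ∃ g : F, FreeGroup.norm (g * W * g⁻¹) = n}

/-! ### Gromov products in free groups -/

/-- The length of the longest common prefix of two lists. -/
def List.commonPrefixLength {β : Type*} [DecidableEq β] : List β → List β → ℕ
  | x :: l, y :: m => if x = y then l.commonPrefixLength m + 1 else 0
  | _, _ => 0

theorem List.commonPrefixLength_comm {β : Type*} [DecidableEq β] (l m : List β) :
    l.commonPrefixLength m = m.commonPrefixLength l := by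
  induction l generalizing m with
  | nil => cases m <;> rfl
  | cons x l ih =>
    cases m with
    | nil => rfl
    | cons y m => simp only [commonPrefixLength, ih m, eq_comm]

theorem List.min_commonPrefixLength_le {β : Type*} [DecidableEq β] (l m n : List β) :
    min (l.commonPrefixLength m) (m.commonPrefixLength n) ≤ l.commonPrefixLength n := by
  induction l generalizing m n with
  | nil => cases m <;> simp [commonPrefixLength]
  | cons x l ih =>
    rcases m with _ | ⟨y, m⟩
    · simp [commonPrefixLength]
    rcases n with _ | ⟨z, n⟩
    · simp [commonPrefixLength]
    have := ih m n
    simp only [commonPrefixLength]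
    split_ifs <;> simp_all

namespace FreeGroup

section Gromov

variable {ι : Type*} [DecidableEq ι]

/-- The Gromov product of two elements of a free group: the length of the longest common
prefix of their reduced words. -/
def gromov (g h : FreeGroup ι) : ℕ := g.toWord.commonPrefixLength h.toWord

theorem gromov_comm (g h : FreeGroup ι) : gromov g h = gromov h g :=
  List.commonPrefixLength_comm _ _

theorem min_gromov_le (g h k : FreeGroup ι) : min (gromov g h) (gromov h k) ≤ gromov g k :=
  List.min_commonPrefixLength_le _ _ _

theorem IsReduced.norm_mk {l : List (ι × Bool)} (hl : IsReduced l) : norm (mk l) = l.length := by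
  rw [norm, toWord_mk, hl.reduce_eq]

theorem norm_mk_inv_mul_mk {l m : List (ι × Bool)} (hl : IsReduced l) (hm : IsReduced m) :
    norm ((mk l)⁻¹ * mk m) + 2 * l.commonPrefixLength m = l.length + m.length := by
  induction l generalizing m with
  | nil => simp [List.commonPrefixLength, ← one_eq_mk, hm.norm_mk]
  | cons x l ih =>
    rcases m with _ | ⟨y, m⟩
    · rw [← one_eq_mk, mul_one, norm_inv_eq, hl.norm_mk]
      simp [List.commonPrefixLength]
    by_cases hxy : x = y
    · subst hxy
      have := ih (m := m) (hl.infix ⟨[x], [], by simp⟩) (hm.infix ⟨[x], [], by simp⟩)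
      have h : (mk (x :: l))⁻¹ * mk (x :: m) = (mk l)⁻¹ * mk m := by
        rw [← List.singleton_append, ← mul_mk, ← List.singleton_append (l := m), ← mul_mk]
        group
      rw [h]
      simp only [List.commonPrefixLength, if_true, List.length_cons]
      omega
    · have hr : IsReduced (invRev (x :: l) ++ y :: m) := by
        have h1 : IsReduced (invRev (x :: l)) := by
          rw [isReduced_iff_reduce_eq, reduce_invRev, hl.reduce_eq]
        refine List.isChain_append.2 ⟨h1, hm, ?_⟩
        simp only [invRev, List.map_cons, List.reverse_cons, List.getLast?_concat,
          Option.mem_def, Option.some.injEq, List.head?_cons]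
        rintro _ rfl _ rfl h
        simp only at h ⊢
        have : x.2 ≠ y.2 := fun h' => hxy (Prod.ext h h')
        revert this
        cases x.2 <;> cases y.2 <;> simp
      rw [inv_mk, mul_mk, hr.norm_mk]
      simp [List.commonPrefixLength, hxy, invRev_length]

theorem norm_inv_mul_add_gromov (g h : FreeGroup ι) :
    norm (g⁻¹ * h) + 2 * gromov g h = norm g + norm h := by
  have := norm_mk_inv_mul_mk (isReduced_toWord (x := g)) (isReduced_toWord (x := h))
  rwa [mk_toWord, mk_toWord] at this

theorem norm_mul_add_gromov (g h : FreeGroup ι) :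
    norm (g * h) + 2 * gromov g⁻¹ h = norm g + norm h := by
  have := norm_inv_mul_add_gromov g⁻¹ h
  rwa [inv_inv, norm_inv_eq] at this

theorem exists_prefix (g : FreeGroup ι) {k : ℕ} (hk : k ≤ norm g) :
    ∃ p : FreeGroup ι, norm p = k ∧ gromov p g = k := by
  have hr : IsReduced (g.toWord.take k) :=
    (isReduced_toWord (x := g)).infix (List.take_prefix k _).isInfix
  have hn : norm (mk (g.toWord.take k)) = k := by
    rw [hr.norm_mk, List.length_take]
    exact min_eq_left hk
  refine ⟨_, hn, ?_⟩
  have h1 := norm_inv_mul_add_gromov (mk (g.toWord.take k)) g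
  have h2 : (mk (g.toWord.take k))⁻¹ * g = mk (g.toWord.drop k) := by
    rw [inv_mul_eq_iff_eq_mul, mul_mk, List.take_append_drop, mk_toWord]
  have h3 : norm (mk (g.toWord.drop k)) = norm g - k := by
    rw [IsReduced.norm_mk, List.length_drop]
    · rfl
    · exact (isReduced_toWord (x := g)).infix (List.drop_suffix k _).isInfix
  rw [h2] at h1
  omega

theorem norm_eq_of_reduceCyclically (x : FreeGroup ι) :
    norm x = 2 * (reduceCyclically.conjugator x.toWord).length +
      (reduceCyclically x.toWord).length := by
  have := congrArg List.length (reduceCyclically.conj_conjugator_reduceCyclically x.toWord)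
  simp only [List.length_append, invRev_length] at this
  rw [norm]
  omega

theorem norm_pow (x : FreeGroup ι) {n : ℕ} (hn : n ≠ 0) :
    norm (x ^ n) = 2 * (reduceCyclically.conjugator x.toWord).length +
      n * (reduceCyclically x.toWord).length := by
  rw [norm, toWord_pow, reduceCyclically.reduce_flatten_replicate isReduced_toWord, if_neg hn]
  simp only [List.length_append, invRev_length, List.length_flatten, List.map_replicate,
    List.sum_replicate, smul_eq_mul]
  omega

theorem reduceCyclically_length_pos {x : FreeGroup ι} (hx : x ≠ 1) :
    0 < (reduceCyclically x.toWord).length := by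
  rw [List.length_pos_iff]
  intro h
  have := reduceCyclically.conj_conjugator_reduceCyclically x.toWord
  rw [h, List.append_nil] at this
  apply hx
  rw [← mk_toWord (x := x), ← this, ← mul_mk, ← inv_mk, mul_inv_cancel]

theorem two_mul_gromov_inv_self_lt {x : FreeGroup ι} (hx : x ≠ 1) :
    2 * gromov x⁻¹ x < norm x := by
  have h1 := norm_mul_add_gromov x x
  rw [← pow_two, norm_pow x two_ne_zero] at h1
  have h2 := norm_eq_of_reduceCyclically x
  have h3 := reduceCyclically_length_pos hx
  omega

/-- Nielsen's condition: if in the image of every reduced word the two cancellations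
affecting a given letter leave some of it untouched, then the map does not decrease lengths. -/
theorem norm_le_norm_map {κ : Type*} [DecidableEq κ] (f : FreeGroup κ →* FreeGroup ι)
    (hf : ∀ x y z : κ × Bool, IsReduced [x, y] → IsReduced [y, z] →
      gromov (f (mk [x]))⁻¹ (f (mk [y])) + gromov (f (mk [y]))⁻¹ (f (mk [z])) <
        norm (f (mk [y]))) (w : FreeGroup κ) : norm w ≤ norm (f w) := by
  have key : ∀ (l : List (κ × Bool)) (x y : κ × Bool), IsReduced (x :: y :: l) →
      gromov (f (mk [x]))⁻¹ (f (mk (y :: l))) = gromov (f (mk [x]))⁻¹ (f (mk [y])) ∧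
      (y :: l).length + gromov (f (mk [x]))⁻¹ (f (mk [y])) ≤ norm (f (mk (y :: l))) := by
    intro l
    induction l with
    | nil =>
      intro x y h
      have := hf x y y h (by simp [IsReduced])
      simp only [List.length_singleton, true_and]
      omega
    | cons z l ih =>
      intro x y h
      have hxy : IsReduced [x, y] := h.infix ⟨[], z :: l, by simp⟩
      have hyz : IsReduced [y, z] := h.infix ⟨[x], l, by simp⟩
      obtain ⟨h1, h2⟩ := ih y z (h.infix ⟨[x], [], by simp⟩)
      have h3 := hf x y z hxy hyz
      have hm : f (mk (y :: z :: l)) = f (mk [y]) * f (mk (z :: l)) := by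
        rw [← f.map_mul, mul_mk, List.singleton_append]
      have h4 := norm_mul_add_gromov (f (mk [y])) (f (mk (z :: l)))
      have h5 := norm_inv_mul_add_gromov (f (mk [y])) (f (mk (y :: z :: l)))
      rw [hm, inv_mul_cancel_left] at h5
      have h6 := min_gromov_le (f (mk [x]))⁻¹ (f (mk [y])) (f (mk (y :: z :: l)))
      have h7 := min_gromov_le (f (mk [x]))⁻¹ (f (mk (y :: z :: l))) (f (mk [y]))
      rw [gromov_comm _ (f (mk [y]))] at h7
      rw [hm] at h6 h7 ⊢
      simp only [List.length_cons] at h2 ⊢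
      omega
  rw [← mk_toWord (x := w), isReduced_toWord.norm_mk]
  have hr := isReduced_toWord (x := w)
  generalize w.toWord = l at hr
  rcases l with _ | ⟨y, l⟩
  · simp
  · have := (key l y y (List.isChain_cons_cons.2 ⟨fun _ => rfl, hr⟩)).2
    omega

end Gromov

end FreeGroup

namespace FreeGroup

section Ties

variable {ι : Type*} [DecidableEq ι]

theorem exists_eq_mul_inv {y : FreeGroup ι} {k : ℕ} (hk : norm y = 2 * k) :
    ∃ p q : FreeGroup ι, y = p * q⁻¹ ∧ norm p = k ∧ norm q = k ∧
      gromov p y = k ∧ gromov q y⁻¹ = k := by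
  obtain ⟨p, hp, hpy⟩ := exists_prefix y (k := k) (by omega)
  have h1 := norm_inv_mul_add_gromov p y
  have h2 : norm (y⁻¹ * p) = norm (p⁻¹ * y) := by rw [← norm_inv_eq, mul_inv_rev, inv_inv]
  have h3 := norm_inv_mul_add_gromov (y⁻¹ * p) y⁻¹
  have h4 : (y⁻¹ * p)⁻¹ * y⁻¹ = p⁻¹ := by group
  rw [h4, norm_inv_eq, norm_inv_eq] at h3
  exact ⟨p, y⁻¹ * p, by group, hp, by omega, hpy, by omega⟩

theorem eq_one_of_half_cancellation {x y : FreeGroup ι} (h1 : 2 * gromov x y = norm y)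
    (h2 : 2 * gromov y⁻¹ x = norm y) : y = 1 := by
  obtain ⟨p, q, hy, hp, hq, hpy, hqy⟩ := exists_eq_mul_inv h1.symm
  have h3 := min_gromov_le p y x
  have h4 := min_gromov_le q y⁻¹ x
  have h5 := min_gromov_le p x q
  rw [gromov_comm y x] at h3
  rw [gromov_comm q x] at h4
  have h6 := norm_inv_mul_add_gromov p q
  have h7 : p⁻¹ * q = 1 := norm_eq_zero.1 (by omega)
  rw [hy, inv_mul_eq_one.1 h7, mul_inv_cancel]

theorem exists_conj_norm_lt {x y : FreeGroup ι} (hy : y ≠ 1) (hxy : norm y ≤ norm x)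
    (h1 : 2 * gromov x⁻¹ y = norm y) (h2 : 2 * gromov y⁻¹ x = norm y) :
    ∃ p : FreeGroup ι, norm (p⁻¹ * (y * x) * p) + norm (p⁻¹ * y * p) < norm x + norm y := by
  have hy0 : norm y ≠ 0 := fun h => hy (norm_eq_zero.1 h)
  obtain ⟨p, q, hyp, hp, hq, hpy, hqy⟩ := exists_eq_mul_inv h1.symm
  refine ⟨p, ?_⟩
  have e1 : p⁻¹ * (y * x) * p = (q⁻¹ * x) * p := by rw [hyp]; group
  have e2 : p⁻¹ * y * p = q⁻¹ * p := by rw [hyp]; group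
  rw [e1, e2]
  have h3 := min_gromov_le p y x⁻¹
  have h4 := min_gromov_le q y⁻¹ x
  rw [gromov_comm y x⁻¹] at h3
  have h5 := norm_inv_mul_add_gromov q x
  have h6 := norm_mul_le q (q⁻¹ * x)
  rw [mul_inv_cancel_left] at h6
  have h7 := norm_inv_mul_add_gromov (q⁻¹ * x)⁻¹ x⁻¹
  have e3 : (q⁻¹ * x)⁻¹⁻¹ * x⁻¹ = q⁻¹ := by group
  rw [e3, norm_inv_eq, norm_inv_eq, norm_inv_eq] at h7
  have h8 := min_gromov_le (q⁻¹ * x)⁻¹ x⁻¹ p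
  rw [gromov_comm x⁻¹ p] at h8
  have h9 := norm_mul_add_gromov (q⁻¹ * x) p
  have h10 := norm_mul_le q⁻¹ p
  rw [norm_inv_eq] at h10
  omega

end Ties

end FreeGroup

/-! ### Generators of the automorphism group of `F(a,b)` -/

/-- The automorphism exchanging `a` and `b`. -/
def swapAut : MulAut F := FreeGroup.freeGroupCongr (Equiv.swap 0 1)

/-- The endomorphism of `F(a,b)` with prescribed values on the generators. -/
def endOf (u v : F) : F →* F := FreeGroup.lift ![u, v]

@[simp] theorem endOf_a (u v : F) : endOf u v a = u := by simp [endOf, a]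

@[simp] theorem endOf_b (u v : F) : endOf u v b = v := by simp [endOf, b]

theorem hom_ext {G : Type*} [Group G] {f g : F →* G} (ha : f a = g a) (hb : f b = g b) :
    f = g := by
  ext i
  fin_cases i
  · exact ha
  · exact hb

theorem aut_ext {f g : MulAut F} (ha : f a = g a) (hb : f b = g b) : f = g := by
  have : f.toMonoidHom = g.toMonoidHom := hom_ext ha hb
  exact MulEquiv.ext fun x => DFunLike.congr_fun this x

/-- The automorphism fixing `a` and inverting `b`. -/
def invAut : MulAut F :=
  MonoidHom.toMulEquiv (endOf a b⁻¹) (endOf a b⁻¹) (hom_ext (by simp) (by simp))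
    (hom_ext (by simp) (by simp))

/-- The transvection sending `a` to `b * a` and fixing `b`. -/
def transvection : MulAut F :=
  MonoidHom.toMulEquiv (endOf (b * a) b) (endOf (b⁻¹ * a) b) (hom_ext (by simp) (by simp))
    (hom_ext (by simp) (by simp))

@[simp] theorem swapAut_a : swapAut a = b := by simp [swapAut, a, b]

@[simp] theorem swapAut_b : swapAut b = a := by simp [swapAut, a, b]

@[simp] theorem invAut_a : invAut a = a := endOf_a a b⁻¹

@[simp] theorem invAut_b : invAut b = b⁻¹ := endOf_b a b⁻¹

@[simp] theorem transvection_a : transvection a = b * a := endOf_a (b * a) b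

@[simp] theorem transvection_b : transvection b = b := endOf_b (b * a) b

/-- The finite group of automorphisms permuting the letters. -/
def signedPerms : Subgroup (MulAut F) := Subgroup.closure {swapAut, invAut}

theorem swapAut_mem : swapAut ∈ signedPerms := Subgroup.subset_closure (by simp)

theorem invAut_mem : invAut ∈ signedPerms := Subgroup.subset_closure (by simp)

theorem mk_singleton (x : Fin 2 × Bool) :
    FreeGroup.mk [x] = cond x.2 (FreeGroup.of x.1) (FreeGroup.of x.1)⁻¹ := by
  rcases x with ⟨i, _ | _⟩ <;> rfl

theorem exists_signedPerm {x y : Fin 2 × Bool} (h : x.1 ≠ y.1) :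
    ∃ σ ∈ signedPerms, σ a = FreeGroup.mk [x] ∧ σ b = FreeGroup.mk [y] := by
  have hs := swapAut_mem
  have hi := invAut_mem
  have hsis := mul_mem (mul_mem hs hi) hs
  obtain ⟨τ, hτ, hτa, hτb⟩ : ∃ τ ∈ signedPerms, τ a = cond x.2 a a⁻¹ ∧ τ b = cond y.2 b b⁻¹ := by
    rcases x.2 with _ | _ <;> rcases y.2 with _ | _
    · exact ⟨swapAut * invAut * swapAut * invAut, mul_mem hsis hi, by simp, by simp⟩
    · exact ⟨swapAut * invAut * swapAut, hsis, by simp, by simp⟩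
    · exact ⟨invAut, hi, by simp, by simp⟩
    · exact ⟨1, one_mem _, by simp, by simp⟩
  simp only [mk_singleton]
  obtain ⟨i, p⟩ := x
  obtain ⟨j, q⟩ := y
  fin_cases i <;> fin_cases j
  · exact absurd rfl h
  · exact ⟨τ, hτ, hτa, hτb⟩
  · refine ⟨swapAut * τ, mul_mem hs hτ, ?_, ?_⟩
    · rw [MulAut.mul_apply, hτa]
      cases p
      · simp [b]
      · simp [b]
    · rw [MulAut.mul_apply, hτb]
      cases q
      · simp [a]
      · simp [a]
  · exact absurd rfl h

theorem exists_mk_singleton_of_norm_le_one {w : F} (h1 : w ≠ 1) (h : FreeGroup.norm w ≤ 1) :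
    ∃ x, w = FreeGroup.mk [x] := by
  have h0 : FreeGroup.norm w ≠ 0 := fun h0 => h1 (FreeGroup.norm_eq_zero.1 h0)
  obtain ⟨x, hx⟩ := List.length_eq_one_iff.1 (show w.toWord.length = 1 by
    change FreeGroup.norm w = 1
    omega)
  exact ⟨x, by rw [← hx, FreeGroup.mk_toWord]⟩

theorem mem_signedPerms_of_norm_le_one {β : MulAut F} (ha : FreeGroup.norm (β a) ≤ 1)
    (hb : FreeGroup.norm (β b) ≤ 1) : β ∈ signedPerms := by
  have ha1 : a ≠ 1 := FreeGroup.of_ne_one 0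
  have hb1 : b ≠ 1 := FreeGroup.of_ne_one 1
  obtain ⟨x, hx⟩ := exists_mk_singleton_of_norm_le_one
    ((map_ne_one_iff β β.injective).2 ha1) ha
  obtain ⟨y, hy⟩ := exists_mk_singleton_of_norm_le_one
    ((map_ne_one_iff β β.injective).2 hb1) hb
  have hxy : x.1 ≠ y.1 := by
    intro hxy
    rcases eq_or_ne x.2 y.2 with h | h
    · have : β a = β b := by rw [hx, hy, Prod.ext hxy h]
      exact absurd (β.injective this) (by decide)
    · have : β a = β b⁻¹ := by
        rw [map_inv, hx, hy, FreeGroup.inv_mk]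
        obtain ⟨i, p⟩ := x
        obtain ⟨j, q⟩ := y
        obtain rfl : i = j := hxy
        cases p <;> cases q <;> simp_all [FreeGroup.invRev]
      exact absurd (β.injective this) (by decide)
  obtain ⟨σ, hσ, hσa, hσb⟩ := exists_signedPerm hxy
  rwa [aut_ext (hx.trans hσa.symm) (hy.trans hσb.symm)]

theorem norm_aut_mk_singleton (α : MulAut F) (x : Fin 2 × Bool) :
    FreeGroup.norm (α (FreeGroup.mk [x])) = FreeGroup.norm (α (FreeGroup.of x.1)) := by
  rw [mk_singleton]
  rcases x.2 with _ | _
  · simp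
  · rfl

theorem aut_mk_singleton_ne_one (α : MulAut F) (x : Fin 2 × Bool) :
    α (FreeGroup.mk [x]) ≠ 1 := by
  rw [map_ne_one_iff α α.injective]
  intro h
  have := (FreeGroup.IsReduced.norm_mk (l := [x]) (by simp [FreeGroup.IsReduced]))
  rw [h] at this
  simp at this

/-- An automorphism which cannot be shortened by a transvection followed by a conjugation,
up to signed permutations, does not decrease lengths. -/
theorem norm_le_norm_of_minimal {α : MulAut F}
    (hα : ∀ x y : Fin 2 × Bool, x.1 ≠ y.1 → ∀ p : F,
      FreeGroup.norm (α (FreeGroup.mk [x])) + FreeGroup.norm (α (FreeGroup.mk [y])) ≤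
        FreeGroup.norm (p⁻¹ * (α (FreeGroup.mk [y]) * α (FreeGroup.mk [x])) * p) +
          FreeGroup.norm (p⁻¹ * α (FreeGroup.mk [y]) * p)) (w : F) : FreeGroup.norm w ≤ FreeGroup.norm (α w) := by
  have hinv : ∀ x : Fin 2 × Bool,
      α (FreeGroup.mk [(x.1, !x.2)]) = (α (FreeGroup.mk [x]))⁻¹ := fun x => by
    rw [← map_inv, FreeGroup.inv_mk]
    rfl
  have hle : ∀ x y : Fin 2 × Bool, x.1 ≠ y.1 →
      FreeGroup.norm (α (FreeGroup.mk [x])) ≤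
        FreeGroup.norm (α (FreeGroup.mk [y]) * α (FreeGroup.mk [x])) := fun x y h => by
    have := hα x y h 1
    simp only [inv_one, one_mul, mul_one] at this
    omega
  have hle' : ∀ x y : Fin 2 × Bool, x.1 ≠ y.1 →
      FreeGroup.norm (α (FreeGroup.mk [y])) ≤
        FreeGroup.norm (α (FreeGroup.mk [y]) * α (FreeGroup.mk [x])) := fun x y h => by
    have := hle (y.1, !y.2) (x.1, !x.2) h.symm
    rwa [hinv, hinv, FreeGroup.norm_inv_eq, ← mul_inv_rev, FreeGroup.norm_inv_eq] at this
  have hself : ∀ x y : Fin 2 × Bool, FreeGroup.IsReduced [x, y] → x.1 = y.1 → x = y := by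
    intro x y h hxy
    simp only [FreeGroup.IsReduced, List.isChain_pair] at h
    exact Prod.ext hxy (h hxy)
  have hhalf : ∀ x y : Fin 2 × Bool, FreeGroup.IsReduced [x, y] →
      2 * FreeGroup.gromov (α (FreeGroup.mk [x]))⁻¹ (α (FreeGroup.mk [y])) ≤
          FreeGroup.norm (α (FreeGroup.mk [x])) ∧
        2 * FreeGroup.gromov (α (FreeGroup.mk [x]))⁻¹ (α (FreeGroup.mk [y])) ≤
          FreeGroup.norm (α (FreeGroup.mk [y])) ∧
        (x.1 = y.1 → 2 * FreeGroup.gromov (α (FreeGroup.mk [x]))⁻¹ (α (FreeGroup.mk [y])) <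
          FreeGroup.norm (α (FreeGroup.mk [y]))) := by
    intro x y h
    by_cases hxy : x.1 = y.1
    · obtain rfl := hself x y h hxy
      have := FreeGroup.two_mul_gromov_inv_self_lt (aut_mk_singleton_ne_one α x)
      exact ⟨this.le, this.le, fun _ => this⟩
    · have h1 := hle y x (Ne.symm hxy)
      have h2 := hle' y x (Ne.symm hxy)
      have h3 := FreeGroup.norm_mul_add_gromov (α (FreeGroup.mk [x])) (α (FreeGroup.mk [y]))
      exact ⟨by omega, by omega, fun h => absurd h hxy⟩
  refine FreeGroup.norm_le_norm_map α.toMonoidHom (fun x y z hxy hyz => ?_) w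
  change FreeGroup.gromov (α (FreeGroup.mk [x]))⁻¹ (α (FreeGroup.mk [y])) +
    FreeGroup.gromov (α (FreeGroup.mk [y]))⁻¹ (α (FreeGroup.mk [z])) < FreeGroup.norm (α (FreeGroup.mk [y]))
  obtain ⟨h1, h2, h3⟩ := hhalf x y hxy
  obtain ⟨h4, -, -⟩ := hhalf y z hyz
  have h4' : y.1 = z.1 → 2 * FreeGroup.gromov (α (FreeGroup.mk [y]))⁻¹ (α (FreeGroup.mk [z])) <
      FreeGroup.norm (α (FreeGroup.mk [y])) := fun h => by
    obtain rfl := hself y z hyz h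
    exact (hhalf y y hyz).2.2 rfl
  by_contra hlt
  have hne1 : x.1 ≠ y.1 := fun h => by have := h3 h; omega
  have hne2 : y.1 ≠ z.1 := fun h => by have := h4' h; omega
  have hxz : x.1 = z.1 := by
    revert hne1 hne2
    generalize x.1 = i
    generalize y.1 = j
    generalize z.1 = k
    decide +revert
  have hy1 := aut_mk_singleton_ne_one α y
  by_cases hxz2 : x.2 = z.2
  · obtain rfl : x = z := Prod.ext hxz hxz2
    obtain ⟨p, hp⟩ := FreeGroup.exists_conj_norm_lt hy1 (by omega)
      (x := α (FreeGroup.mk [x])) (by omega) (by omega)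
    have := hα x y hne1 p
    omega
  · have hz : z = (x.1, !x.2) := Prod.ext hxz.symm (Bool.eq_not.2 (Ne.symm hxz2))
    rw [hz, hinv] at hlt h4
    exact hy1 (FreeGroup.eq_one_of_half_cancellation (x := (α (FreeGroup.mk [x]))⁻¹)
      (by omega) (by omega))

/-- Nielsen's theorem in rank two. -/
theorem eq_top_of_nielsen {T : Subgroup (MulAut F)} (hs : swapAut ∈ T) (hi : invAut ∈ T)
    (ht : transvection ∈ T) (hc : ∀ g : F, MulAut.conj g ∈ T) : T = ⊤ := by
  have hσT : signedPerms ≤ T := by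
    rw [signedPerms, Subgroup.closure_le]
    rintro _ (rfl | rfl) <;> assumption
  rw [eq_top_iff]
  rintro α -
  induction hn : FreeGroup.norm (α a) + FreeGroup.norm (α b) using Nat.strong_induction_on generalizing α with
  | _ n ih =>
  by_contra hα
  have hmin : ∀ t ∈ T, ∀ g : F,
      n ≤ FreeGroup.norm ((MulAut.conj g * α * t) a) + FreeGroup.norm ((MulAut.conj g * α * t) b) := by
    intro t htT g
    by_contra! hlt
    have := ih _ hlt rfl
    rw [Subgroup.mul_mem_cancel_right _ htT, Subgroup.mul_mem_cancel_left _ (hc g)] at this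
    exact hα this
  have hlen : ∀ w : F, FreeGroup.norm w ≤ FreeGroup.norm (α w) := by
    refine norm_le_norm_of_minimal fun x y hxy p => ?_
    obtain ⟨σ, hσ, hσa, hσb⟩ := exists_signedPerm hxy
    have := hmin (σ * transvection) (mul_mem (hσT hσ) ht) p⁻¹
    simp only [MulAut.mul_apply, MulAut.conj_apply, transvection_a, transvection_b, map_mul,
      hσa, hσb, inv_inv] at this
    have e : p⁻¹ * (α (FreeGroup.mk [y]) * α (FreeGroup.mk [x])) * p =
        p⁻¹ * α (FreeGroup.mk [y]) * p * (p⁻¹ * α (FreeGroup.mk [x]) * p) := by group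
    rw [e]
    refine le_trans (le_of_eq ?_) this
    rw [norm_aut_mk_singleton, norm_aut_mk_singleton, ← hn]
    obtain ⟨i, _⟩ := x
    obtain ⟨j, _⟩ := y
    fin_cases i <;> fin_cases j
    · exact absurd rfl hxy
    · rfl
    · exact add_comm _ _
    · exact absurd rfl hxy
  have hinv : α⁻¹ ∈ signedPerms := by
    apply mem_signedPerms_of_norm_le_one
    · simpa [a] using hlen (α⁻¹ a)
    · simpa [b] using hlen (α⁻¹ b)
  exact hα (inv_mem_iff.1 (hσT hinv))

/-! ### Effect of a transvection on the length -/

/-- The sum of a weight over the pairs of consecutive entries of a list. -/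
def List.pairSum {β : Type*} (f : β → β → ℤ) : List β → ℤ
  | x :: y :: l => f x y + (y :: l).pairSum f
  | _ => 0

theorem List.pairSum_map {β γ : Type*} (f : γ → γ → ℤ) (π : β → γ) (l : List β) :
    (l.map π).pairSum f = l.pairSum fun x y => f (π x) (π y) := by
  induction l with
  | nil => rfl
  | cons x l ih =>
    cases l with
    | nil => rfl
    | cons y l =>
      simp only [List.map_cons, pairSum] at ih ⊢
      rw [ih]

theorem List.abs_pairSum_sub_le {β : Type*} {R : β → β → Prop} {f g : β → β → ℤ} {ψ : β → ℤ}
    (h : ∀ x y, R x y → f x y - g x y = ψ y - ψ x) (hψ : ∀ x, ψ x = 0 ∨ ψ x = 1) {l : List β}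
    (hl : l.IsChain R) : |l.pairSum f - l.pairSum g| ≤ 1 := by
  have key : ∀ (l : List β) (x : β), (x :: l).IsChain R → ∃ y,
      (x :: l).pairSum f - (x :: l).pairSum g = ψ y - ψ x := by
    intro l
    induction l with
    | nil => exact fun x _ => ⟨x, by simp [pairSum]⟩
    | cons z l ih =>
      intro x hx
      rw [List.isChain_cons_cons] at hx
      obtain ⟨y, hy⟩ := ih z hx.2
      refine ⟨y, ?_⟩
      have := h x z hx.1
      simp only [pairSum]
      omega
  rcases l with _ | ⟨x, l⟩
  · simp [pairSum]
  · obtain ⟨y, hy⟩ := key l x hl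
    rw [hy, abs_le]
    rcases hψ x with h1 | h1 <;> rcases hψ y with h2 | h2 <;> omega

/-- The number of letters `a` and `a⁻¹` in a word. -/
def countA : List (Fin 2 × Bool) → ℤ
  | [] => 0
  | x :: l => (if x.1 = 0 then 1 else 0) + countA l

/-- The indicator of the pairs of letters `b⁻¹a` and `a⁻¹b`, at which the image of a word
under the transvection is not reduced. -/
def cancelWeight (x y : Fin 2 × Bool) : ℤ :=
  if x.1 ≠ y.1 ∧ x.2 = false ∧ y.2 = true then 1 else 0

/-- The effect of `invAut` on letters. -/
def invLetter (x : Fin 2 × Bool) : Fin 2 × Bool := (x.1, if x.1 = 1 then !x.2 else x.2)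

/-- The effect of `swapAut` on letters. -/
def swapLetter (x : Fin 2 × Bool) : Fin 2 × Bool := (Equiv.swap 0 1 x.1, x.2)

theorem toWord_aut_eq_map {σ : MulAut F} {π : Fin 2 × Bool → Fin 2 × Bool}
    (hσ : ∀ x, σ (FreeGroup.mk [x]) = FreeGroup.mk [π x])
    (hπ : ∀ x y, (x.1 = y.1 → x.2 = y.2) → ((π x).1 = (π y).1 → (π x).2 = (π y).2)) (w : F) :
    (σ w).toWord = w.toWord.map π := by
  have h1 : ∀ l : List (Fin 2 × Bool), σ (FreeGroup.mk l) = FreeGroup.mk (l.map π) := by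
    intro l
    induction l with
    | nil => simp [← FreeGroup.one_eq_mk]
    | cons x l ih =>
      rw [← List.singleton_append, ← FreeGroup.mul_mk, map_mul, hσ, ih, FreeGroup.mul_mk]
      rfl
  have h2 : FreeGroup.IsReduced (w.toWord.map π) := by
    rw [FreeGroup.IsReduced, List.isChain_map]
    exact (FreeGroup.isReduced_toWord (x := w)).imp hπ
  conv_lhs => rw [← FreeGroup.mk_toWord (x := w), h1, FreeGroup.toWord_mk, h2.reduce_eq]

theorem toWord_invAut (w : F) : (invAut w).toWord = w.toWord.map invLetter := by
  refine toWord_aut_eq_map ?_ (by decide) w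
  rintro ⟨i, p⟩
  have ha := invAut_a
  have hb := invAut_b
  simp only [a, b] at ha hb
  fin_cases i <;> cases p <;> simp [mk_singleton, invLetter, ha, hb]

theorem toWord_swapAut (w : F) : (swapAut w).toWord = w.toWord.map swapLetter := by
  refine toWord_aut_eq_map ?_ (by decide) w
  rintro ⟨i, p⟩
  have ha := swapAut_a
  have hb := swapAut_b
  simp only [a, b] at ha hb
  fin_cases i <;> cases p <;> simp [mk_singleton, swapLetter, ha, hb]

theorem norm_invAut (w : F) : FreeGroup.norm (invAut w) = FreeGroup.norm w := by
  rw [FreeGroup.norm, toWord_invAut, List.length_map, FreeGroup.norm]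

theorem norm_swapAut (w : F) : FreeGroup.norm (swapAut w) = FreeGroup.norm w := by
  rw [FreeGroup.norm, toWord_swapAut, List.length_map, FreeGroup.norm]

theorem isReduced_cons_cons {ι : Type*} {x y : ι × Bool} {l : List (ι × Bool)} :
    FreeGroup.IsReduced (x :: y :: l) ↔ (x.1 = y.1 → x.2 = y.2) ∧ FreeGroup.IsReduced (y :: l) :=
  List.isChain_cons_cons

/-- The possible beginnings of the image under the transvection of a reduced word, in terms of
the first letter of the word. -/
def TransvectionHead : List (Fin 2 × Bool) → List (Fin 2 × Bool) → Prop
  | [], m => m = []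
  | (0, true) :: _, m => ∃ v, m = (1, true) :: (0, true) :: v
  | (0, false) :: _, m => ∃ v, m = (0, false) :: v
  | (1, true) :: _, m => ∃ v, m = (1, true) :: v ∧ (0, true) ∉ v.head?
  | (1, false) :: _, m => ∃ v, m = (1, false) :: v ∨ m = (0, true) :: v

theorem mk_cons (x : Fin 2 × Bool) (l : List (Fin 2 × Bool)) :
    FreeGroup.mk (x :: l) = FreeGroup.mk [x] * FreeGroup.mk l := by
  rw [FreeGroup.mul_mk]
  rfl

theorem mk_cons_cons_not (i : Fin 2) (p : Bool) (l : List (Fin 2 × Bool)) :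
    FreeGroup.mk ((i, p) :: (i, !p) :: l) = FreeGroup.mk l := by
  rw [mk_cons, mk_cons (i, !p), mk_singleton, mk_singleton]
  cases p <;> simp

theorem transvection_mk_cons (x : Fin 2 × Bool) (l : List (Fin 2 × Bool)) :
    transvection (FreeGroup.mk (x :: l)) =
      transvection (FreeGroup.mk [x]) * transvection (FreeGroup.mk l) := by
  rw [mk_cons, map_mul]

theorem transvection_mk_a : transvection (FreeGroup.mk [(0, true)]) =
    FreeGroup.mk [(1, true), (0, true)] := by
  rw [mk_cons (1, true), mk_singleton, mk_singleton]
  exact transvection_a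

theorem transvection_mk_a_inv : transvection (FreeGroup.mk [(0, false)]) =
    FreeGroup.mk [(0, false), (1, false)] := by
  rw [mk_cons (0, false) [(1, false)], mk_singleton, mk_singleton]
  simpa [a, b] using congrArg (·⁻¹) transvection_a

theorem transvection_mk_b (p : Bool) : transvection (FreeGroup.mk [(1, p)]) =
    FreeGroup.mk [(1, p)] := by
  have h := transvection_b
  rw [b] at h
  rw [mk_singleton]
  cases p <;> simp [h]

theorem exists_word_transvection (l : List (Fin 2 × Bool)) (hl : FreeGroup.IsReduced l) :
    ∃ m, FreeGroup.IsReduced m ∧ FreeGroup.mk m = transvection (FreeGroup.mk l) ∧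
      TransvectionHead l m ∧
      (m.length : ℤ) + 2 * l.pairSum cancelWeight = l.length + countA l := by
  induction l with
  | nil => exact ⟨[], by simp, by simp [← FreeGroup.one_eq_mk], rfl, by simp [List.pairSum, countA]⟩
  | cons x l ih =>
    obtain ⟨m, hm, hml, hh, hn⟩ := ih (hl.infix ⟨[x], [], by simp⟩)
    rw [transvection_mk_cons, ← hml]
    rcases x with ⟨i, p⟩
    fin_cases i <;> cases p <;> simp only [Fin.zero_eta, Fin.mk_one, Fin.isValue] at hl ⊢
    · rw [transvection_mk_a_inv, FreeGroup.mul_mk]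
      rcases l with _ | ⟨⟨j, q⟩, l⟩
      · obtain rfl : m = [] := hh
        refine ⟨[(0, false), (1, false)], by simp, rfl, ⟨_, rfl⟩, ?_⟩
        simp [List.pairSum, countA]
      · rw [isReduced_cons_cons] at hl
        fin_cases j <;> cases q
        · obtain ⟨v, rfl⟩ := hh
          refine ⟨_, ?_, rfl, ⟨_, rfl⟩, ?_⟩
          · simpa [isReduced_cons_cons] using hm
          · simp [List.pairSum, countA, cancelWeight] at hn ⊢
            omega
        · simp at hl
        · obtain ⟨v, rfl | rfl⟩ := hh
          all_goals
            refine ⟨_, ?_, rfl, ⟨_, rfl⟩, ?_⟩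
            · simpa [isReduced_cons_cons] using hm
            · simp [List.pairSum, countA, cancelWeight] at hn ⊢
              omega
        · obtain ⟨v, rfl, hv⟩ := hh
          refine ⟨(0, false) :: v, ?_, ?_, ⟨_, rfl⟩, ?_⟩
          · rw [FreeGroup.IsReduced, List.isChain_cons] at hm ⊢
            refine ⟨?_, hm.2⟩
            rintro ⟨j, q⟩ hy h
            cases q
            · rfl
            · exact absurd (by simpa [show j = 0 from h.symm] using hy) hv
          · rw [mk_cons (0, false), List.cons_append, mk_cons (0, false)]
            exact congrArg _ (mk_cons_cons_not 1 false v).symm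
          · simp [List.pairSum, countA, cancelWeight] at hn ⊢
            omega
    · rw [transvection_mk_a, FreeGroup.mul_mk]
      refine ⟨_, ?_, rfl, ⟨_, rfl⟩, ?_⟩
      · rcases l with _ | ⟨⟨j, q⟩, l⟩
        · obtain rfl : m = [] := hh
          simp
        · rw [isReduced_cons_cons] at hl
          fin_cases j <;> cases q
          · simp at hl
          · obtain ⟨v, rfl⟩ := hh
            simpa [isReduced_cons_cons] using hm
          · obtain ⟨v, rfl | rfl⟩ := hh <;> simpa [isReduced_cons_cons] using hm
          · obtain ⟨v, rfl, -⟩ := hh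
            simpa [isReduced_cons_cons] using hm
      · rcases l with _ | ⟨y, l⟩
        · obtain rfl : m = [] := hh
          simp [List.pairSum, countA]
        · simp [List.pairSum, countA, cancelWeight] at hn ⊢
          omega
    · rw [transvection_mk_b, FreeGroup.mul_mk]
      rcases l with _ | ⟨⟨j, q⟩, l⟩
      · obtain rfl : m = [] := hh
        refine ⟨[(1, false)], by simp, rfl, ⟨_, .inl rfl⟩, ?_⟩
        simp [List.pairSum, countA]
      · rw [isReduced_cons_cons] at hl
        fin_cases j <;> cases q
        · obtain ⟨v, rfl⟩ := hh
          refine ⟨_, ?_, rfl, ⟨_, .inl rfl⟩, ?_⟩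
          · simpa [isReduced_cons_cons] using hm
          · simp [List.pairSum, countA, cancelWeight] at hn ⊢
            omega
        · obtain ⟨v, rfl⟩ := hh
          refine ⟨(0, true) :: v, hm.tail, ?_, ⟨_, .inr rfl⟩, ?_⟩
          · exact (mk_cons_cons_not 1 false _).symm
          · simp [List.pairSum, countA, cancelWeight] at hn ⊢
            omega
        · obtain ⟨v, rfl | rfl⟩ := hh
          all_goals
            refine ⟨_, ?_, rfl, ⟨_, .inl rfl⟩, ?_⟩
            · simpa [isReduced_cons_cons] using hm
            · simp [List.pairSum, countA, cancelWeight] at hn ⊢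
              omega
        · simp at hl
    · rw [transvection_mk_b, FreeGroup.mul_mk]
      have h0 : (1, false) ∉ m.head? ∧ (0, true) ∉ m.head? := by
        rcases l with _ | ⟨⟨j, q⟩, l⟩
        · obtain rfl : m = [] := hh
          simp
        · rw [isReduced_cons_cons] at hl
          fin_cases j <;> cases q
          · obtain ⟨v, rfl⟩ := hh
            simp
          · obtain ⟨v, rfl⟩ := hh
            simp
          · simp at hl
          · obtain ⟨v, rfl, -⟩ := hh
            simp
      refine ⟨_, ?_, rfl, ⟨_, rfl, h0.2⟩, ?_⟩
      · rw [FreeGroup.IsReduced, List.singleton_append, List.isChain_cons]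
        refine ⟨?_, hm⟩
        rintro ⟨j, q⟩ hy h
        cases q
        · exact absurd (by simpa [show j = 1 from h.symm] using hy) h0.1
        · rfl
      · rcases l with _ | ⟨y, l⟩
        · obtain rfl : m = [] := hh
          simp [List.pairSum, countA]
        · simp [List.pairSum, countA, cancelWeight] at hn ⊢
          omega

/-- The number of pairs of consecutive letters `b⁻¹a` and `a⁻¹b` of the reduced word. -/
def cancelCount (w : F) : ℤ := w.toWord.pairSum cancelWeight

theorem norm_transvection (w : F) :
    (FreeGroup.norm (transvection w) : ℤ) + 2 * cancelCount w =
      FreeGroup.norm w + countA w.toWord := by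
  obtain ⟨m, hm, hmw, -, h⟩ := exists_word_transvection w.toWord FreeGroup.isReduced_toWord
  rw [FreeGroup.mk_toWord] at hmw
  rwa [← hmw, hm.norm_mk]

theorem invAut_mul_self : invAut * invAut = 1 := aut_ext (by simp) (by simp)

theorem swapAut_mul_self : swapAut * swapAut = 1 := aut_ext (by simp) (by simp)

theorem transvection_inv : transvection⁻¹ = invAut * transvection * invAut :=
  inv_eq_of_mul_eq_one_right (aut_ext (by simp) (by simp))

theorem countA_map_invLetter (l : List (Fin 2 × Bool)) : countA (l.map invLetter) = countA l := by
  induction l with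
  | nil => rfl
  | cons x l ih => simp only [List.map_cons, countA, ih, invLetter]

theorem cancelCount_invAut (w : F) : cancelCount (invAut w) =
    w.toWord.pairSum fun x y => cancelWeight (invLetter x) (invLetter y) := by
  rw [cancelCount, toWord_invAut, List.pairSum_map]

theorem norm_transvection_inv (w : F) :
    (FreeGroup.norm (transvection⁻¹ w) : ℤ) + 2 * cancelCount (invAut w) =
      FreeGroup.norm w + countA w.toWord := by
  have h := norm_transvection (invAut w)
  rw [norm_invAut, toWord_invAut, countA_map_invLetter] at h
  rw [transvection_inv, MulAut.mul_apply, MulAut.mul_apply, norm_invAut, h]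

theorem cancelCount_add_le (w : F) :
    cancelCount w + cancelCount (invAut w) ≤ countA w.toWord := by
  have key : ∀ (l : List (Fin 2 × Bool)) (x : Fin 2 × Bool), (x :: l).pairSum cancelWeight +
      ((x :: l).pairSum fun x y => cancelWeight (invLetter x) (invLetter y)) +
        (if x = (0, true) then 1 else 0) ≤ countA (x :: l) := by
    intro l
    induction l with
    | nil =>
      intro x
      revert x
      decide
    | cons y l ih =>
      intro x
      have h1 := ih y
      have h2 : ∀ x y : Fin 2 × Bool,
          cancelWeight x y + cancelWeight (invLetter x) (invLetter y) +
            (if x = (0, true) then 1 else 0) ≤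
            (if x.1 = 0 then 1 else 0) + (if y = (0, true) then 1 else 0) := by decide
      have h3 := h2 x y
      rw [countA]
      simp only [List.pairSum] at h1 ⊢
      linarith
  rw [cancelCount_invAut, cancelCount]
  rcases w.toWord with _ | ⟨x, l⟩
  · simp [List.pairSum, countA]
  · have := key l x
    split_ifs at this <;> linarith

/-- The difference of the lengths of the images under the transvection and its inverse. -/
noncomputable def lengthDiff (w : F) : ℤ :=
  FreeGroup.norm (transvection w) - FreeGroup.norm (transvection⁻¹ w)

theorem lengthDiff_eq (w : F) : lengthDiff w = 2 * (cancelCount (invAut w) - cancelCount w) := by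
  have h1 := norm_transvection w
  have h2 := norm_transvection_inv w
  rw [lengthDiff]
  linarith

theorem two_mul_norm_le (w : F) : 2 * FreeGroup.norm w ≤
    FreeGroup.norm (transvection w) + FreeGroup.norm (transvection⁻¹ w) := by
  have h1 := norm_transvection w
  have h2 := norm_transvection_inv w
  have h3 := cancelCount_add_le w
  omega

theorem lengthDiff_invAut (w : F) : lengthDiff (invAut w) = -lengthDiff w := by
  rw [lengthDiff_eq, lengthDiff_eq, ← MulAut.mul_apply, invAut_mul_self, MulAut.one_apply]
  ring

theorem abs_lengthDiff_swapAut_sub_le (w : F) : |lengthDiff (swapAut w) - lengthDiff w| ≤ 2 := by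
  have h1 : cancelCount (swapAut w) = cancelCount w := by
    rw [cancelCount, toWord_swapAut, List.pairSum_map, cancelCount]
    congr 1
    funext x y
    revert x y
    decide
  have h2 : |cancelCount (invAut (swapAut w)) - cancelCount (invAut w)| ≤ 1 := by
    rw [cancelCount_invAut, cancelCount_invAut, toWord_swapAut, List.pairSum_map]
    refine List.abs_pairSum_sub_le
      (ψ := fun x => if (x.1 = 0 ↔ x.2 = true) then 0 else 1) (by decide) ?_
      FreeGroup.isReduced_toWord
    intro x
    split_ifs <;> simp
  rw [lengthDiff_eq, lengthDiff_eq, h1, abs_le] at *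
  omega

theorem norm_apply_of_mem_signedPerms {σ : MulAut F} (hσ : σ ∈ signedPerms) (w : F) :
    FreeGroup.norm (σ w) = FreeGroup.norm w := by
  induction hσ using Subgroup.closure_induction generalizing w with
  | mem σ h =>
    rcases h with rfl | rfl
    · exact norm_swapAut w
    · exact norm_invAut w
  | one => rfl
  | mul σ τ _ _ ih₁ ih₂ => rw [MulAut.mul_apply, ih₁, ih₂]
  | inv σ _ ih => rw [← ih, MulAut.apply_inv_self]

theorem exists_abs_lengthDiff_sub_le {σ : MulAut F} (hσ : σ ∈ signedPerms) :
    ∃ C : ℤ, ∀ w, abs (|lengthDiff (σ w)| - |lengthDiff w|) ≤ C := by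
  induction hσ using Subgroup.closure_induction with
  | mem σ h =>
    rcases h with rfl | rfl
    · exact ⟨2, fun w => (abs_abs_sub_abs_le _ _).trans (abs_lengthDiff_swapAut_sub_le w)⟩
    · exact ⟨0, fun w => by simp [lengthDiff_invAut]⟩
  | one => exact ⟨0, by simp⟩
  | mul σ τ _ _ ih₁ ih₂ =>
    obtain ⟨C, hC⟩ := ih₁
    obtain ⟨D, hD⟩ := ih₂
    refine ⟨C + D, fun w => ?_⟩
    have h1 := hC (τ w)
    have h2 := hD w
    rw [MulAut.mul_apply]
    rw [abs_le] at *
    omega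
  | inv σ _ ih =>
    obtain ⟨C, hC⟩ := ih
    refine ⟨C, fun w => ?_⟩
    have h := hC (σ⁻¹ w)
    rwa [MulAut.apply_inv_self, abs_sub_comm] at h

/-- The transvection fixing `a` and sending `b` to `a * b`. -/
def transvection' : MulAut F := swapAut * transvection * swapAut

theorem transvection'_apply_of_mem {w : F} (hw : w ∈ H) : transvection' w = w := by
  suffices H ≤ (transvection'.toMonoidHom).eqLocus (MonoidHom.id F) from this hw
  rw [H, Subgroup.closure_le]
  rintro _ (rfl | rfl)
  · change transvection' a = a
    simp [transvection']
  · change transvection' (b⁻¹ * a * b) = b⁻¹ * a * b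
    simp [transvection', mul_assoc]

theorem abs_lengthDiff_le_of_mem {w : F} (hw : w ∈ H) : |lengthDiff w| ≤ 2 := by
  have h0 := transvection'_apply_of_mem hw
  simp only [transvection', MulAut.mul_apply] at h0
  have h1 : transvection (swapAut w) = swapAut w := by
    have h := congrArg swapAut h0
    rwa [← MulAut.mul_apply, swapAut_mul_self, MulAut.one_apply] at h
  have h2 : transvection⁻¹ (swapAut w) = swapAut w := by
    conv_lhs => rw [← h1, MulAut.inv_apply_self]
  have h3 := abs_lengthDiff_swapAut_sub_le w
  rwa [lengthDiff, h1, h2, sub_self, zero_sub, abs_neg] at h3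

theorem exists_bound_of_mem_mclosure {p : MulAut F}
    (hp : p ∈ Submonoid.closure {transvection, transvection'}) (K : ℤ) :
    ∃ C : ℤ, ∀ w, -K ≤ lengthDiff w →
      -C ≤ lengthDiff (p w) ∧ (FreeGroup.norm w : ℤ) ≤ FreeGroup.norm (p w) + C := by
  have ht : ∀ w, lengthDiff w ≤ lengthDiff (transvection w) ∧
      2 * FreeGroup.norm w + lengthDiff w ≤ 2 * FreeGroup.norm (transvection w) := by
    intro w
    have h1 := two_mul_norm_le w
    have h2 := two_mul_norm_le (transvection w)
    simp only [lengthDiff, MulAut.inv_apply_self] at *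
    omega
  induction hp using Submonoid.closure_induction generalizing K with
  | mem p h =>
    rcases h with rfl | rfl
    · refine ⟨|K|, fun w hw => ?_⟩
      have h1 := ht w
      have h2 := le_abs_self K
      have h3 := abs_nonneg K
      omega
    · refine ⟨|K| + 4, fun w hw => ?_⟩
      have h1 := ht (swapAut w)
      have h2 := le_abs_self K
      have h3 := abs_nonneg K
      have h4 := abs_le.1 (abs_lengthDiff_swapAut_sub_le w)
      have h5 := abs_le.1 (abs_lengthDiff_swapAut_sub_le (transvection (swapAut w)))
      rw [norm_swapAut] at h1
      simp only [transvection', MulAut.mul_apply, norm_swapAut]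
      omega
  | one => exact ⟨|K|, fun w hw => by
      have h2 := le_abs_self K
      have h3 := abs_nonneg K
      rw [MulAut.one_apply]
      omega⟩
  | mul p q _ _ ih₁ ih₂ =>
    obtain ⟨C, hC⟩ := ih₂ K
    obtain ⟨D, hD⟩ := ih₁ C
    refine ⟨|C| + |D|, fun w hw => ?_⟩
    have h1 := hC w hw
    have h2 := hD (q w) h1.1
    have h3 := le_abs_self C
    have h4 := le_abs_self D
    have h5 := abs_nonneg C
    rw [MulAut.mul_apply]
    omega

/-! ### A positive normal form -/

section NormalForm

variable {Q : Type*} [Group Q] {s e l : Q}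

theorem conj_mem_of_mem_closure_pair (hs : s * s = 1) (he : e * e = 1) (hel : e * l * e = l⁻¹)
    (hsel : s * e * s * l * (s * e * s) = l⁻¹) {σ : Q} (hσ : σ ∈ Subgroup.closure {s, e}) :
    ∀ x ∈ ({l, l⁻¹, s * l * s, (s * l * s)⁻¹} : Set Q),
      σ⁻¹ * x * σ ∈ ({l, l⁻¹, s * l * s, (s * l * s)⁻¹} : Set Q) := by
  have hs' : s⁻¹ = s := inv_eq_of_mul_eq_one_left hs
  have he' : e⁻¹ = e := inv_eq_of_mul_eq_one_left he
  have hers : e * (s * l * s) * e = (s * l * s)⁻¹ := by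
    have h : e * (s * l * s) * e = s * (s * e * s * l * (s * e * s)) * s := by
      simp only [mul_assoc, hs, mul_one]
      rw [← mul_assoc s s, hs, one_mul]
    rw [h, hsel]
    simp only [mul_inv_rev, hs', mul_assoc]
  have h1 : ∀ y ∈ ({s, e} : Set Q), ∀ x ∈ ({l, l⁻¹, s * l * s, (s * l * s)⁻¹} : Set Q),
      y⁻¹ * x * y ∈ ({l, l⁻¹, s * l * s, (s * l * s)⁻¹} : Set Q) := by
    have hinv : ∀ x y : Q, y⁻¹ = y → y * x⁻¹ * y = (y * x * y)⁻¹ := fun x y h => by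
      simp only [mul_inv_rev, h, mul_assoc]
    have h2 : s * (s * l * s) * s = l := by
      simp only [mul_assoc, hs, mul_one]
      rw [← mul_assoc, hs, one_mul]
    rintro y (rfl | rfl) x (rfl | rfl | rfl | rfl) <;>
      simp only [hinv _ _ hs', hinv _ _ he', hs', he', hel, hers, h2, inv_inv, Set.mem_insert_iff,
        Set.mem_singleton_iff, true_or, or_true]
  induction hσ using Subgroup.closure_induction_left with
  | one => simp
  | mul_left y hy σ _ ih =>
    intro x hx
    have := ih _ (h1 y hy x hx)
    simpa [mul_assoc] using this
  | inv_mul_cancel y hy σ _ ih =>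
    intro x hx
    have hy' : y⁻¹ = y := by rcases hy with rfl | rfl <;> assumption
    have := ih _ (h1 y hy x hx)
    rw [hy']
    simpa [mul_assoc] using this

theorem exists_eq_mul_of_mem_closure (hs : s * s = 1) (he : e * e = 1) (hel : e * l * e = l⁻¹)
    (hsel : s * e * s * l * (s * e * s) = l⁻¹) (hl : l⁻¹ * (s * l * s) = e * s * l)
    {q : Q} (hq : q ∈ Subgroup.closure {s, e, l}) :
    ∃ σ ∈ Subgroup.closure {s, e}, ∃ p ∈ Submonoid.closure {l, s * l * s},
      ∃ τ ∈ Subgroup.closure {s, e}, q = σ * p * τ := by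
  have hs' : s⁻¹ = s := inv_eq_of_mul_eq_one_left hs
  have hsm : s ∈ Subgroup.closure {s, e} := Subgroup.subset_closure (by simp)
  have hem : e ∈ Subgroup.closure {s, e} := Subgroup.subset_closure (by simp)
  have hlm : l ∈ Submonoid.closure {l, s * l * s} := Submonoid.subset_closure (by simp)
  have hrm : s * l * s ∈ Submonoid.closure {l, s * l * s} := Submonoid.subset_closure (by simp)
  have hX : ∀ x ∈ ({l, l⁻¹, s * l * s, (s * l * s)⁻¹} : Set Q),
      ∀ p ∈ Submonoid.closure {l, s * l * s}, ∃ σ ∈ Subgroup.closure {s, e},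
        ∃ p' ∈ Submonoid.closure {l, s * l * s}, ∃ τ ∈ Subgroup.closure {s, e},
          x * p = σ * p' * τ := by
    intro x hx p hp
    rcases hx with rfl | rfl | rfl | rfl
    · exact ⟨1, one_mem _, _, mul_mem hlm hp, 1, one_mem _, by simp⟩
    · induction hp using Submonoid.closure_induction_left with
      | one => exact ⟨e, hem, l, hlm, e, hem, by rw [hel, mul_one]⟩
      | mul_left y hy p hp _ =>
        rcases hy with rfl | rfl
        · exact ⟨1, one_mem _, p, hp, 1, one_mem _, by simp⟩
        · exact ⟨e * s, mul_mem hem hsm, l * p, mul_mem hlm hp, 1, one_mem _, by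
            rw [← mul_assoc, hl, mul_one, mul_assoc]⟩
    · exact ⟨1, one_mem _, _, mul_mem hrm hp, 1, one_mem _, by simp⟩
    · induction hp using Submonoid.closure_induction_left with
      | one => exact ⟨s * e, mul_mem hsm hem, l, hlm, e * s, mul_mem hem hsm, by
            rw [mul_one, mul_inv_rev, mul_inv_rev, hs', ← hel]
            simp only [mul_assoc]⟩
      | mul_left y hy p hp _ =>
        rcases hy with rfl | rfl
        · refine ⟨s * e, mul_mem hsm hem, s * y * s * p, mul_mem hrm hp, 1, one_mem _, ?_⟩
          have h : (s * y * s)⁻¹ * y = s * (y⁻¹ * (s * y * s)) * s := by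
            simp only [mul_inv_rev, hs', mul_assoc, hs, mul_one]
          rw [← mul_assoc, h, hl]
          simp only [mul_assoc, mul_one]
        · exact ⟨1, one_mem _, p, hp, 1, one_mem _, by
            rw [inv_mul_cancel_left, one_mul, mul_one]⟩
  have hstep : ∀ x ∈ ({l, l⁻¹} : Set Q), ∀ σ ∈ Subgroup.closure {s, e},
      ∀ p ∈ Submonoid.closure {l, s * l * s}, ∀ τ ∈ Subgroup.closure {s, e},
        ∃ σ' ∈ Subgroup.closure {s, e}, ∃ p' ∈ Submonoid.closure {l, s * l * s},
          ∃ τ' ∈ Subgroup.closure {s, e}, x * (σ * p * τ) = σ' * p' * τ' := by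
    intro x hx σ hσ p hp τ hτ
    have h1 := conj_mem_of_mem_closure_pair hs he hel hsel hσ x (by
      rcases hx with rfl | rfl <;> simp)
    obtain ⟨σ', hσ', p', hp', τ', hτ', h⟩ := hX _ h1 p hp
    refine ⟨σ * σ', mul_mem hσ hσ', p', hp', τ' * τ, mul_mem hτ' hτ, ?_⟩
    have h2 : x * (σ * p * τ) = σ * (σ⁻¹ * x * σ * p) * τ := by group
    rw [h2, h]
    simp only [mul_assoc]
  induction hq using Subgroup.closure_induction_left with
  | one => exact ⟨1, one_mem _, 1, one_mem _, 1, one_mem _, by simp⟩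
  | mul_left y hy q _ ih =>
    obtain ⟨σ, hσ, p, hp, τ, hτ, rfl⟩ := ih
    rcases hy with rfl | rfl | rfl
    · exact ⟨_, mul_mem hsm hσ, p, hp, τ, hτ, by simp only [mul_assoc]⟩
    · exact ⟨_, mul_mem hem hσ, p, hp, τ, hτ, by simp only [mul_assoc]⟩
    · exact hstep y (by simp) σ hσ p hp τ hτ
  | inv_mul_cancel y hy q _ ih =>
    obtain ⟨σ, hσ, p, hp, τ, hτ, rfl⟩ := ih
    rcases hy with rfl | rfl | rfl
    · exact ⟨_, mul_mem (inv_mem hsm) hσ, p, hp, τ, hτ, by simp only [mul_assoc]⟩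
    · exact ⟨_, mul_mem (inv_mem hem) hσ, p, hp, τ, hτ, by simp only [mul_assoc]⟩
    · exact hstep y⁻¹ (by simp) σ hσ p hp τ hτ

end NormalForm

/-! ### Lengths of images of elements of `H` -/

instance : (MulAut.conj : F →* MulAut F).range.Normal where
  conj_mem := by
    rintro _ ⟨g, rfl⟩ α
    refine ⟨α g, MulEquiv.ext fun x => ?_⟩
    simp [MulAut.conj_apply]

theorem exists_eq_conj_mul (α : MulAut F) : ∃ g : F, ∃ σ ∈ signedPerms,
    ∃ p ∈ Submonoid.closure {transvection, transvection'}, ∃ τ ∈ signedPerms,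
      α = MulAut.conj g * (σ * p * τ) := by
  let π := QuotientGroup.mk' (MulAut.conj : F →* MulAut F).range
  have hconj : ∀ g, π (MulAut.conj g) = 1 := fun g =>
    (QuotientGroup.eq_one_iff _).2 ⟨g, rfl⟩
  have htop : (Subgroup.closure {π swapAut, π invAut, π transvection}).comap π = ⊤ :=
    eq_top_of_nielsen (Subgroup.subset_closure (by simp)) (Subgroup.subset_closure (by simp))
      (Subgroup.subset_closure (by simp)) fun g => by
        rw [Subgroup.mem_comap, hconj]
        exact one_mem _
  have hα : π α ∈ Subgroup.closure {π swapAut, π invAut, π transvection} := by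
    rw [← Subgroup.mem_comap, htop]
    trivial
  have hs : π swapAut * π swapAut = 1 := by rw [← map_mul, swapAut_mul_self, map_one]
  have he : π invAut * π invAut = 1 := by rw [← map_mul, invAut_mul_self, map_one]
  have hel : π invAut * π transvection * π invAut = (π transvection)⁻¹ := by
    rw [← map_mul, ← map_mul, ← transvection_inv, map_inv]
  have hsel : π swapAut * π invAut * π swapAut * π transvection *
      (π swapAut * π invAut * π swapAut) = (π transvection)⁻¹ := by
    have h : swapAut * invAut * swapAut * transvection * (swapAut * invAut * swapAut) =
        MulAut.conj b * transvection⁻¹ := by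
      rw [transvection_inv]
      apply aut_ext <;> simp [mul_assoc]
    simpa only [map_mul, hconj, one_mul, map_inv] using congrArg π h
  have hl : (π transvection)⁻¹ * (π swapAut * π transvection * π swapAut) =
      π invAut * π swapAut * π transvection := by
    have h : transvection⁻¹ * (swapAut * transvection * swapAut) =
        MulAut.conj b⁻¹ * (invAut * swapAut * transvection) := by
      rw [transvection_inv]
      apply aut_ext <;> simp [mul_assoc]
    simpa only [map_mul, hconj, one_mul, map_inv, inv_one] using congrArg π h
  have hperm : Subgroup.closure {π swapAut, π invAut} = signedPerms.map π := by
    rw [signedPerms, MonoidHom.map_closure, Set.image_pair]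
  have hpos : Submonoid.closure {π transvection, π swapAut * π transvection * π swapAut} =
      (Submonoid.closure {transvection, transvection'}).map π := by
    rw [MonoidHom.map_mclosure, Set.image_pair, transvection', map_mul, map_mul]
  have h := exists_eq_mul_of_mem_closure hs he hel hsel hl hα
  rw [hperm, hpos] at h
  obtain ⟨_, ⟨σ, hσ, rfl⟩, _, ⟨p, hp, rfl⟩, _, ⟨τ, hτ, rfl⟩, h⟩ := h
  rw [← map_mul, ← map_mul] at h
  obtain ⟨g, hg⟩ := QuotientGroup.eq.1 h.symm
  refine ⟨(σ * p * τ) g, σ, hσ, p, hp, τ, hτ, ?_⟩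
  rw [← mul_inv_cancel_left (σ * p * τ) α, ← hg]
  exact MulEquiv.ext fun x => by simp [MulAut.conj_apply]

theorem norm_conj_le (g w : F) :
    FreeGroup.norm (g * w * g⁻¹) ≤ FreeGroup.norm w + 2 * FreeGroup.norm g := by
  have h1 := FreeGroup.norm_mul_le (g * w) g⁻¹
  have h2 := FreeGroup.norm_mul_le g w
  rw [FreeGroup.norm_inv_eq] at h1
  omega

theorem exists_norm_le_norm_aut_add (α : MulAut F) :
    ∃ C : ℤ, ∀ w ∈ H, (FreeGroup.norm w : ℤ) ≤ FreeGroup.norm (α w) + C := by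
  obtain ⟨g, σ, hσ, p, hp, τ, hτ, rfl⟩ := exists_eq_conj_mul α
  obtain ⟨K, hK⟩ := exists_abs_lengthDiff_sub_le hτ
  obtain ⟨C, hC⟩ := exists_bound_of_mem_mclosure hp (K + 2)
  refine ⟨C + 2 * FreeGroup.norm g, fun w hw => ?_⟩
  have h1 := hK w
  have h2 := abs_lengthDiff_le_of_mem hw
  have h3 := neg_abs_le (lengthDiff (τ w))
  rw [abs_le] at h1
  have h4 := (hC (τ w) (by omega)).2
  rw [norm_apply_of_mem_signedPerms hτ] at h4
  have h5 := norm_conj_le g⁻¹ (g * σ (p (τ w)) * g⁻¹)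
  have h6 : g⁻¹ * (g * σ (p (τ w)) * g⁻¹) * g⁻¹⁻¹ = σ (p (τ w)) := by group
  rw [h6, norm_apply_of_mem_signedPerms hσ, FreeGroup.norm_inv_eq] at h5
  simp only [MulAut.mul_apply, MulAut.conj_apply]
  omega

/-! ### Cyclically reduced length and powers -/

theorem exists_norm_conj_eq_cyclNorm (W : F) :
    ∃ g : F, FreeGroup.norm (g * W * g⁻¹) = cyclNorm W :=
  Nat.sInf_mem (s := {n : ℕ | ∃ g : F, FreeGroup.norm (g * W * g⁻¹) = n}) ⟨_, 1, rfl⟩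

theorem cyclNorm_le_reduceCyclically_length (W : F) :
    cyclNorm W ≤ (FreeGroup.reduceCyclically W.toWord).length := by
  set c := FreeGroup.mk (FreeGroup.reduceCyclically.conjugator W.toWord) with hc
  have h : c⁻¹ * W * c⁻¹⁻¹ = FreeGroup.mk (FreeGroup.reduceCyclically W.toWord) := by
    have := congrArg FreeGroup.mk
      (FreeGroup.reduceCyclically.conj_conjugator_reduceCyclically W.toWord)
    rw [FreeGroup.mk_toWord, ← FreeGroup.mul_mk, ← FreeGroup.mul_mk, ← FreeGroup.inv_mk, ← hc]
      at this
    nth_rw 1 [← this]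
    group
  have h1 : cyclNorm W ≤ FreeGroup.norm (c⁻¹ * W * c⁻¹⁻¹) := Nat.sInf_le ⟨c⁻¹, rfl⟩
  rw [h] at h1
  exact h1.trans FreeGroup.norm_mk_le

theorem mul_cyclNorm_le_norm_pow (W : F) (n : ℕ) : n * cyclNorm W ≤ FreeGroup.norm (W ^ n) := by
  rcases eq_or_ne n 0 with rfl | hn
  · simp
  · rw [FreeGroup.norm_pow W hn]
    exact (Nat.mul_le_mul_left n (cyclNorm_le_reduceCyclically_length W)).trans
      (Nat.le_add_left _ _)

theorem exists_norm_pow_le (W : F) :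
    ∃ C : ℕ, ∀ n : ℕ, FreeGroup.norm (W ^ n) ≤ n * cyclNorm W + C := by
  obtain ⟨g, hg⟩ := exists_norm_conj_eq_cyclNorm W
  refine ⟨2 * FreeGroup.norm g, fun n => ?_⟩
  have hpow : FreeGroup.norm ((g * W * g⁻¹) ^ n) ≤ n * cyclNorm W := by
    induction n with
    | zero => simp
    | succ n ih =>
      rw [pow_succ, Nat.succ_mul]
      exact (FreeGroup.norm_mul_le _ _).trans (Nat.add_le_add ih hg.le)
  have h := norm_conj_le g⁻¹ ((g * W * g⁻¹) ^ n)
  rw [conj_pow, show g⁻¹ * (g * W ^ n * g⁻¹) * g⁻¹⁻¹ = W ^ n by group, FreeGroup.norm_inv_eq] at h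
  rw [conj_pow] at hpow
  omega

/-- No automorphism of `F(a,b)` strictly decreases the cyclically reduced length of an
element of `⟨a, b⁻¹ab⟩`. -/
theorem cyclNorm_le_cyclNorm_aut (W : F) (hW : W ∈ H) (α : F ≃* F) :
    cyclNorm W ≤ cyclNorm (α W) := by
  obtain ⟨C, hC⟩ := exists_norm_le_norm_aut_add α
  obtain ⟨D, hD⟩ := exists_norm_pow_le (α W)
  by_contra! h
  have h1 := mul_cyclNorm_le_norm_pow W (C.toNat + D + 1)
  have h2 := hC _ (pow_mem hW (C.toNat + D + 1))
  have h3 := hD (C.toNat + D + 1)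
  rw [← map_pow] at h3
  have h4 := Nat.mul_le_mul_left (C.toNat + D + 1) h
  rw [Nat.mul_succ] at h4
  omega
end

section
/- Let n > 1 be an integer and let S ∈ F(a,b). Then S has shortest length in its Aut(F(a,b))-orbit if and only if S^n has shortest length in its Aut(F(a,b))-orbit; that is, |S| ≤ |α(S)| for all automorphisms α of F(a,b) if and only if |S^n| ≤ |α(S^n)| for all automorphisms α of F(a,b). -/
open FreeGroup in
/-- Every element of a free group is conjugate to one whose length is multiplicative under powers,
and the conjugation adds the same amount `k` to the length of each positive power. -/
theorem exists_conj_norm_pow {α : Type*} [DecidableEq α] (x : FreeGroup α) :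
    ∃ (g : FreeGroup α) (k : ℕ), ∀ n : ℕ, n ≠ 0 →
      norm (MulAut.conj g x ^ n) = n * norm (MulAut.conj g x) ∧
      norm (x ^ n) = k + n * norm (MulAut.conj g x) := by
  set c := reduceCyclically.conjugator x.toWord with hc
  set u := reduceCyclically x.toWord with hu
  have hcyc : IsCyclicallyReduced u := reduceCyclically.isCyclicallyReduced isReduced_toWord
  have hx : x = mk c * mk u * (mk c)⁻¹ := by
    rw [inv_mk, mul_mk, mul_mk, reduceCyclically.conj_conjugator_reduceCyclically, mk_toWord]
  have hconj : MulAut.conj (mk c)⁻¹ x = mk u := by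
    rw [MulAut.conj_apply, hx]
    group
  have hnorm : norm (mk u) = u.length := by
    rw [FreeGroup.norm, toWord_mk, hcyc.isReduced.reduce_eq]
  refine ⟨(mk c)⁻¹, 2 * c.length, fun n hn => ?_⟩
  rw [hconj, hnorm]
  constructor
  · rw [FreeGroup.norm, toWord_pow, toWord_mk, hcyc.isReduced.reduce_eq,
      (hcyc.flatten_replicate n).isReduced.reduce_eq]
    simp
  · rw [FreeGroup.norm, toWord_pow, reduceCyclically.reduce_flatten_replicate isReduced_toWord, if_neg hn,
      ← hc, ← hu]
    simp only [List.length_append, invRev_length, List.length_flatten, List.map_replicate,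
      List.sum_replicate, smul_eq_mul]
    ring

/-- For `n > 1`, an element `S` of `F(a,b)` has shortest length in its
`Aut F(a,b)`-orbit if and only if `S^n` does. -/
theorem shortest_iff_pow_shortest (n : ℕ) (hn : 1 < n) (S : F) :
    (∀ α : F ≃* F, FreeGroup.norm S ≤ FreeGroup.norm (α S)) ↔
    (∀ α : F ≃* F, FreeGroup.norm (S ^ n) ≤ FreeGroup.norm (α (S ^ n))) := by
  have hn0 : n ≠ 0 := by omega
  obtain ⟨g, k, hg⟩ := exists_conj_norm_pow S
  obtain ⟨hgn, hSn⟩ := hg n hn0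
  have hS := (hg 1 one_ne_zero).2
  rw [pow_one, one_mul] at hS
  constructor <;> intro h α <;> obtain ⟨g', k', hg'⟩ := exists_conj_norm_pow (α S) <;>
    obtain ⟨hgn', hαn⟩ := hg' n hn0
  · have hk := h (MulAut.conj g)
    have hα : _ ≤ FreeGroup.norm (MulAut.conj g' (α S)) := h (α.trans (MulAut.conj g'))
    rw [map_pow, hSn, hαn]
    have := Nat.mul_le_mul_left n hα
    have : n * FreeGroup.norm (MulAut.conj g S) ≤ n * FreeGroup.norm S :=
      Nat.mul_le_mul_left n (by omega)
    omega
  · have hk := h (MulAut.conj g)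
    have hα : _ ≤ FreeGroup.norm (MulAut.conj g' (α (S ^ n))) := h (α.trans (MulAut.conj g'))
    have hαS := (hg' 1 one_ne_zero).2
    rw [pow_one, one_mul] at hαS
    rw [map_pow, hgn, hSn] at hk
    rw [map_pow, map_pow, hgn', hSn] at hα
    have := Nat.le_of_mul_le_mul_left (le_trans (Nat.le_add_left _ _) hα) (by omega)
    omega
end

section
/- Let S ∈ F(a,b) be nontrivial and not a proper power (i.e., if S = U^m for some U ∈ F(a,b) and integer m, then m = 1 or m = −1), and let n > 1 be an integer. Then the following are equivalent: (i) there exists T in the Aut(F(a,b))-orbit of S^n which has shortest length in that orbit, lies in ⟨a, b⁻¹ab⟩, and is not conjugate in F(a,b) to [a,b]^k for any integer k; (ii) there exists T' in the Aut(F(a,b))-orbit of S which has shortest length in that orbit, lies in ⟨a, b⁻¹ab⟩, and is conjugate in F(a,b) to neither [a,b] nor [a,b]⁻¹. -/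
/-- The commutator `[a,b] = aba⁻¹b⁻¹`. -/
def commAB : F := a * b * a⁻¹ * b⁻¹

namespace FreeGroup

variable {α : Type*}

theorem exists_zpow_of_commute {x y : FreeGroup α} (h : Commute x y) :
    ∃ (g : FreeGroup α) (p q : ℤ), x = g ^ p ∧ y = g ^ q := by
  let K : Subgroup (FreeGroup α) := Subgroup.closure {x, y}
  have hK : ∀ u v : K, u * v = v * u := by
    have : IsMulCommutative K := by
      apply Subgroup.isMulCommutative_closure
      rintro u (rfl | rfl) v (rfl | rfl)
      exacts [rfl, h, h.symm, rfl]
    exact fun u v => mul_comm' u v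
  have hsub : Subsingleton (IsFreeGroup.Generators K) := by
    refine ⟨fun i j => ?_⟩
    by_contra hij
    have : of i * of j = of j * of i := by
      apply (IsFreeGroup.toFreeGroup K).symm.injective
      rw [_root_.map_mul, _root_.map_mul, hK]
    classical
    have := congrArg toWord this
    simp [toWord_mul, toWord_of, reduce.cons, hij] at this
  have hcyc : IsCyclic (FreeGroup (IsFreeGroup.Generators K)) := by
    rcases isEmpty_or_nonempty (IsFreeGroup.Generators K) with _ | ⟨⟨i⟩⟩
    · infer_instance
    · let : Unique (IsFreeGroup.Generators K) := ⟨⟨i⟩, fun _ => Subsingleton.elim _ _⟩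
      infer_instance
  have hcycK : IsCyclic K :=
    isCyclic_of_surjective (IsFreeGroup.toFreeGroup K).symm
      (IsFreeGroup.toFreeGroup K).symm.surjective
  obtain ⟨g, hg⟩ := hcycK.exists_generator
  obtain ⟨p, hp⟩ := hg ⟨x, Subgroup.subset_closure (by simp)⟩
  obtain ⟨q, hq⟩ := hg ⟨y, Subgroup.subset_closure (by simp)⟩
  exact ⟨g, p, q, (congrArg Subtype.val hp).symm, (congrArg Subtype.val hq).symm⟩

variable [DecidableEq α]

open reduceCyclically

theorem toWord_pow_eq (x : FreeGroup α) {n : ℕ} (hn : n ≠ 0) :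
    (x ^ n).toWord = conjugator x.toWord ++
      (List.replicate n (reduceCyclically x.toWord)).flatten ++ invRev (conjugator x.toWord) := by
  rw [toWord_pow, reduce_flatten_replicate isReduced_toWord, if_neg hn]

theorem norm_pow_eq (x : FreeGroup α) {n : ℕ} (hn : n ≠ 0) :
    norm (x ^ n) = n * (reduceCyclically x.toWord).length +
      2 * (conjugator x.toWord).length := by
  simp only [norm, toWord_pow_eq x hn, List.length_append, List.length_flatten, List.map_replicate,
    List.sum_replicate, smul_eq_mul, invRev_length]
  ring

theorem norm_pow_le (x : FreeGroup α) (n : ℕ) : norm (x ^ n) ≤ n * norm x := by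
  induction n with
  | zero => simp
  | succ n ih =>
    rw [pow_succ, add_mul, one_mul]
    exact (norm_mul_le _ _).trans (by gcongr)

theorem isCyclicallyReduced_of_conjugator_eq_nil {x : FreeGroup α}
    (h : conjugator x.toWord = []) : IsCyclicallyReduced x.toWord := by
  have h₁ := conj_conjugator_reduceCyclically x.toWord
  have h₂ := reduceCyclically.isCyclicallyReduced (isReduced_toWord (x := x))
  simp only [h, List.nil_append, invRev_empty, List.append_nil] at h₁
  rwa [h₁] at h₂

theorem IsCyclicallyReduced.of_toWord_pow {x : FreeGroup α} {n : ℕ} (hn : n ≠ 0)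
    (h : IsCyclicallyReduced (x ^ n).toWord) : IsCyclicallyReduced x.toWord := by
  apply isCyclicallyReduced_of_conjugator_eq_nil
  rw [toWord_pow_eq x hn] at h
  cases hc : conjugator x.toWord with
  | nil => rfl
  | cons y l =>
    rw [hc] at h
    have := h.2 (y.1, !y.2) (by rw [List.getLast?_append]; simp [invRev]) y (by simp) rfl
    simp at this

theorem IsCyclicallyReduced.toWord_pow {x : FreeGroup α} (h : IsCyclicallyReduced x.toWord)
    (n : ℕ) : (x ^ n).toWord = (List.replicate n x.toWord).flatten := by
  rw [FreeGroup.toWord_pow, (h.flatten_replicate n).isReduced.reduce_eq]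

theorem IsCyclicallyReduced.norm_pow {x : FreeGroup α} (h : IsCyclicallyReduced x.toWord)
    (n : ℕ) : norm (x ^ n) = n * norm x := by
  simp [norm, h.toWord_pow]

theorem exists_norm_conj_le (x : FreeGroup α) : ∃ g : FreeGroup α,
    norm (g * x * g⁻¹) ≤ (reduceCyclically x.toWord).length := by
  refine ⟨(mk (conjugator x.toWord))⁻¹, ?_⟩
  have h : (mk (conjugator x.toWord))⁻¹ * x * (mk (conjugator x.toWord))⁻¹⁻¹ =
      mk (reduceCyclically x.toWord) := by
    have := congrArg mk (conj_conjugator_reduceCyclically x.toWord)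
    rw [mk_toWord, ← mul_mk, ← mul_mk, ← inv_mk] at this
    nth_rewrite 2 [← this]
    group
  rw [h]
  exact norm_mk_le

theorem isCyclicallyReduced_of_norm_le_conj {x : FreeGroup α}
    (h : ∀ g : FreeGroup α, norm x ≤ norm (g * x * g⁻¹)) : IsCyclicallyReduced x.toWord := by
  apply isCyclicallyReduced_of_conjugator_eq_nil
  obtain ⟨g, hg⟩ := exists_norm_conj_le x
  have h₁ := (h g).trans hg
  have h₂ := norm_pow_eq x one_ne_zero
  rw [pow_one] at h₂
  exact List.length_eq_zero_iff.mp (by omega)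

end FreeGroup

theorem toWord_commAB : commAB.toWord = [(0, true), (1, true), (0, false), (1, false)] := by
  decide

theorem eq_one_of_commAB_eq_pow {g : F} {p : ℕ} (h : commAB = g ^ p) : p = 1 := by
  have hp : p ≠ 0 := by
    rintro rfl
    have := congrArg FreeGroup.toWord h
    simp [toWord_commAB] at this
  have hg : FreeGroup.IsCyclicallyReduced g.toWord := by
    refine FreeGroup.IsCyclicallyReduced.of_toWord_pow hp ?_
    rw [← h, toWord_commAB]
    simp [FreeGroup.isCyclicallyReduced_iff, FreeGroup.IsReduced]
  have hc := congrArg (List.count (0, true)) (hg.toWord_pow p)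
  rw [← h, toWord_commAB, List.count_flatten, List.map_replicate, List.sum_replicate] at hc
  exact Nat.dvd_one.mp ⟨_, by simpa using hc⟩

theorem eq_one_or_neg_one_of_commAB_eq_zpow {g : F} {p : ℤ} (h : commAB = g ^ p) :
    p = 1 ∨ p = -1 := by
  obtain ⟨m, rfl | rfl⟩ := p.eq_nat_or_neg
  · left
    exact_mod_cast eq_one_of_commAB_eq_pow (g := g) (by simpa using h)
  · right
    rw [eq_one_of_commAB_eq_pow (g := g⁻¹) (p := m) (by simpa using h)]
    rfl

/-- If an element that is not a proper power has a nontrivial power which is a power of `[a,b]`,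
then it is `[a,b]` or its inverse. -/
theorem eq_commAB_or_inv_of_pow_eq_zpow {x : F} {n : ℕ} {k : ℤ} (hn : n ≠ 0)
    (hx : ∀ (U : F) (m : ℤ), x = U ^ m → m = 1 ∨ m = -1) (h : x ^ n = commAB ^ k) :
    x = commAB ∨ x = commAB⁻¹ := by
  have hcomm : Commute x commAB := by
    have h₁ : Commute (x ^ n) commAB := h ▸ (Commute.refl commAB).zpow_left k
    have h₂ : (commAB * x * commAB⁻¹) ^ n = x ^ n := by
      rw [conj_pow, ← h₁.eq, mul_inv_cancel_right]
    exact (mul_inv_eq_iff_eq_mul.mp (pow_left_injective hn h₂)).symm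
  obtain ⟨g, p, q, rfl, hq⟩ := FreeGroup.exists_zpow_of_commute hcomm
  rcases hx g p rfl with rfl | rfl <;>
    rcases eq_one_or_neg_one_of_commAB_eq_zpow hq with rfl | rfl <;> simp [hq]

/-- The relation "`L` labels a path from `s` to `t`" in the Stallings graph of `⟨a, b⁻¹ab⟩`, which
has base point `false`, loops labelled `a` at both vertices, and an edge labelled `b` from `true`
to `false`. -/
def Reads : Bool → List (Fin 2 × Bool) → Bool → Prop
  | s, [], t => s = t
  | s, x :: L, t => (x.1 = 0 ∧ Reads s L t) ∨ (x.1 = 1 ∧ s = x.2 ∧ Reads (!s) L t)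

theorem reads_append {s t : Bool} {L₁ L₂ : List (Fin 2 × Bool)} :
    Reads s (L₁ ++ L₂) t ↔ ∃ r, Reads s L₁ r ∧ Reads r L₂ t := by
  induction L₁ generalizing s with
  | nil => simp [Reads]
  | cons x L ih =>
    simp only [List.cons_append, Reads, ih]
    grind

theorem Reads.invRev {s t : Bool} {L : List (Fin 2 × Bool)} (h : Reads s L t) :
    Reads t (FreeGroup.invRev L) s := by
  induction L generalizing s with
  | nil => exact Eq.symm h
  | cons x L ih =>
    rw [FreeGroup.invRev_cons, reads_append]
    rcases h with ⟨hx, h⟩ | ⟨hx, rfl, h⟩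
    · exact ⟨s, ih h, by simp [FreeGroup.invRev, Reads, hx]⟩
    · exact ⟨_, ih h, by simp [FreeGroup.invRev, Reads, hx]⟩

theorem Reads.of_step {s t : Bool} {L₁ L₂ : List (Fin 2 × Bool)} (h : Reads s L₁ t)
    (hs : FreeGroup.Red.Step L₁ L₂) : Reads s L₂ t := by
  cases hs
  rw [reads_append] at h ⊢
  obtain ⟨r, h₁, h₂⟩ := h
  refine ⟨r, h₁, ?_⟩
  simp only [Reads] at h₂
  grind

theorem Reads.of_red {s t : Bool} {L₁ L₂ : List (Fin 2 × Bool)} (h : Reads s L₁ t)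
    (hr : FreeGroup.Red L₁ L₂) : Reads s L₂ t := by
  induction hr with
  | refl => exact h
  | tail _ hs ih => exact ih.of_step hs

theorem reads_toWord_of_mem_H {x : F} (hx : x ∈ H) : Reads false x.toWord false := by
  have : ∃ L, FreeGroup.mk L = x ∧ Reads false L false := by
    induction hx using Subgroup.closure_induction with
    | mem y hy =>
      refine ⟨y.toWord, FreeGroup.mk_toWord, ?_⟩
      rcases hy with rfl | rfl
      · simp [a, Reads]
      · have : (b⁻¹ * a * b).toWord = [(1, false), (0, true), (1, true)] := by decide
        simp [this, Reads]
    | one => exact ⟨[], rfl, rfl⟩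
    | mul y z _ _ hy hz =>
      obtain ⟨L₁, rfl, h₁⟩ := hy
      obtain ⟨L₂, rfl, h₂⟩ := hz
      exact ⟨L₁ ++ L₂, FreeGroup.mul_mk.symm, reads_append.mpr ⟨_, h₁, h₂⟩⟩
    | inv y _ hy =>
      obtain ⟨L, rfl, h⟩ := hy
      exact ⟨_, FreeGroup.inv_mk.symm, h.invRev⟩
  obtain ⟨L, rfl, h⟩ := this
  rw [FreeGroup.toWord_mk]
  exact h.of_red FreeGroup.reduce.red

theorem Reads.mem_H {s t : Bool} {L : List (Fin 2 × Bool)} (h : Reads s L t) :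
    cond s b⁻¹ 1 * FreeGroup.mk L * (cond t b⁻¹ 1)⁻¹ ∈ H := by
  induction L generalizing s with
  | nil =>
    obtain rfl : s = t := h
    rw [← FreeGroup.one_eq_mk, mul_one, mul_inv_cancel]
    exact H.one_mem
  | cons x L ih =>
    have ha : a ∈ H := Subgroup.subset_closure (by simp)
    have hb : b⁻¹ * a * b ∈ H := Subgroup.subset_closure (by simp)
    suffices ∃ r, Reads r L t ∧ cond s b⁻¹ 1 * FreeGroup.mk [x] * (cond r b⁻¹ 1)⁻¹ ∈ H by
      obtain ⟨r, hr, hx⟩ := this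
      have := H.mul_mem hx (ih hr)
      rw [← List.singleton_append, ← FreeGroup.mul_mk]
      convert this using 1
      group
    have ha_false : FreeGroup.mk [(0, false)] = a⁻¹ := rfl
    have hb_false : FreeGroup.mk [(1, false)] = b⁻¹ := rfl
    have ha_true : FreeGroup.mk [(0, true)] = a := rfl
    have hb_true : FreeGroup.mk [(1, true)] = b := rfl
    obtain ⟨i, e⟩ := x
    rcases h with ⟨rfl : i = 0, h⟩ | ⟨rfl : i = 1, rfl : s = e, h⟩
    · refine ⟨s, h, ?_⟩
      cases s <;> cases e
      · simpa [ha_false] using ha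
      · simpa [ha_true] using ha
      · simpa [ha_false, mul_assoc] using H.inv_mem hb
      · simpa [ha_true] using hb
    · refine ⟨_, h, ?_⟩
      cases s <;> simp [hb_false, hb_true, H.one_mem]

/-- The exponent sum of `b`. -/
def bExponent : F →* Multiplicative ℤ :=
  FreeGroup.lift ![1, Multiplicative.ofAdd 1]

theorem bExponent_a : bExponent a = 1 := by
  simp [bExponent, a]

theorem bExponent_b : bExponent b = Multiplicative.ofAdd 1 := by
  simp [bExponent, b]

theorem bExponent_eq_one_of_mem_H {x : F} (hx : x ∈ H) : bExponent x = 1 := by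
  have : H ≤ bExponent.ker := by
    refine (Subgroup.closure_le _).mpr ?_
    rintro y (rfl | rfl) <;> simp [MonoidHom.mem_ker, bExponent_a]
  exact this hx

theorem mem_H_of_pow_mem {x : F} {n : ℕ} (hn : n ≠ 0)
    (hx : FreeGroup.IsCyclicallyReduced x.toWord) (h : x ^ n ∈ H) : x ∈ H := by
  have hexp : bExponent x = 1 := by
    have := bExponent_eq_one_of_mem_H h
    rw [map_pow] at this
    exact (pow_eq_one_iff_left hn).mp this
  obtain ⟨m, rfl⟩ := Nat.exists_eq_succ_of_ne_zero hn
  have hr := reads_toWord_of_mem_H h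
  rw [hx.toWord_pow, List.replicate_succ, List.flatten_cons, reads_append] at hr
  obtain ⟨t, ht, -⟩ := hr
  have := ht.mem_H
  rw [FreeGroup.mk_toWord] at this
  cases t
  · simpa using this
  · have := bExponent_eq_one_of_mem_H this
    simp [hexp, bExponent_b] at this

/-- For `S` nontrivial and not a proper power, and `n > 1`: the orbit of `S^n` contains
a shortest element of `⟨a, b⁻¹ab⟩` not conjugate to any power of `[a,b]` if and only if
the orbit of `S` contains a shortest element of `⟨a, b⁻¹ab⟩` conjugate to neither
`[a,b]` nor `[a,b]⁻¹`. -/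
theorem pow_orbit_shortest_iff (S : F) (hS : S ≠ 1)
    (hroot : ∀ (U : F) (m : ℤ), S = U ^ m → m = 1 ∨ m = -1)
    (n : ℕ) (hn : 1 < n) :
    (∃ T : F, (∃ α : F ≃* F, α (S ^ n) = T) ∧
      (∀ α : F ≃* F, FreeGroup.norm T ≤ FreeGroup.norm (α (S ^ n))) ∧
      T ∈ H ∧ ¬ ∃ k : ℤ, IsConj T (commAB ^ k)) ↔
    (∃ T' : F, (∃ α : F ≃* F, α S = T') ∧
      (∀ α : F ≃* F, FreeGroup.norm T' ≤ FreeGroup.norm (α S)) ∧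
      T' ∈ H ∧ ¬ IsConj T' commAB ∧ ¬ IsConj T' commAB⁻¹) := by
  have hn0 : n ≠ 0 := by omega
  have hroot' (α : F ≃* F) (U : F) (m : ℤ) (h : α S = U ^ m) : m = 1 ∨ m = -1 :=
    hroot (α.symm U) m (by rw [← map_zpow, ← h, α.symm_apply_apply])
  have hshort {R : F} (α : F ≃* F)
      (h : ∀ β : F ≃* F, FreeGroup.norm (α R) ≤ FreeGroup.norm (β R)) :
      FreeGroup.IsCyclicallyReduced (α R).toWord :=
    FreeGroup.isCyclicallyReduced_of_norm_le_conj fun g => h (α.trans (MulAut.conj g))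
  constructor
  · rintro ⟨_, ⟨α, rfl⟩, hmin, hH, hconj⟩
    have hcyc := hshort α hmin
    rw [map_pow] at hcyc hH hconj
    replace hcyc := hcyc.of_toWord_pow hn0
    refine ⟨α S, ⟨α, rfl⟩, fun β => ?_, mem_H_of_pow_mem hn0 hcyc hH, fun h => ?_, fun h => ?_⟩
    · have := hmin β
      rw [map_pow, map_pow, hcyc.norm_pow] at this
      exact Nat.le_of_mul_le_mul_left (this.trans (FreeGroup.norm_pow_le _ _)) (by omega)
    · exact hconj ⟨n, by simpa using h.pow n⟩
    · exact hconj ⟨-n, by simpa using h.pow n⟩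
  · rintro ⟨_, ⟨α, rfl⟩, hmin, hH, hc, hc'⟩
    have hcyc := hshort α hmin
    refine ⟨α S ^ n, ⟨α, map_pow _ _ _⟩, fun β => ?_, H.pow_mem hH n, ?_⟩
    · obtain ⟨g, hg⟩ := FreeGroup.exists_norm_conj_le (β S)
      have hle := (hmin (β.trans (MulAut.conj g))).trans hg
      rw [hcyc.norm_pow, map_pow, FreeGroup.norm_pow_eq _ hn0]
      exact (Nat.mul_le_mul_left n hle).trans (Nat.le_add_right _ _)
    · rintro ⟨k, hk⟩
      obtain ⟨g, hg⟩ := isConj_iff.mp hk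
      rw [← conj_pow] at hg
      rcases eq_commAB_or_inv_of_pow_eq_zpow hn0
        (hroot' (α.trans (MulAut.conj g))) hg with h | h
      · exact hc (isConj_iff.mpr ⟨g, h⟩)
      · exact hc' (isConj_iff.mpr ⟨g, h⟩)
end

section
/- Let W ∈ F(a,b) be an element whose image under the homomorphism F(a,b) → ℤ sending a ↦ 0 and b ↦ 1 is zero (i.e., the exponent sum of b in W is zero). Then W ∈ ⟨a, b⁻¹ab⟩ if and only if for every prefix p of the reduced word of W, the exponent sum of b in p is −1 or 0. -/
/-- The exponent sum of `b` in a word over `{a, a⁻¹, b, b⁻¹}`: occurrences of `b`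
minus occurrences of `b⁻¹`.  (This computes the image under the homomorphism
`F(a,b) → ℤ` with `a ↦ 0`, `b ↦ 1` when applied to the reduced word.) -/
def bSum (w : List (Fin 2 × Bool)) : ℤ :=
  (w.map fun l => if l.1 = 1 then (if l.2 then (1 : ℤ) else -1) else 0).sum

theorem bSum_cons (x : Fin 2 × Bool) (w : List (Fin 2 × Bool)) :
    bSum (x :: w) = bSum [x] + bSum w := by
  simp [bSum]

/-- All partial `b`-exponent sums of the word, started at height `n`, are `-1` or `0`. -/
def InStrip : ℤ → List (Fin 2 × Bool) → Prop
  | n, [] => n = -1 ∨ n = 0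
  | n, x :: w => (n = -1 ∨ n = 0) ∧ InStrip (n + bSum [x]) w

theorem InStrip.start {n : ℤ} {w : List (Fin 2 × Bool)} (h : InStrip n w) : n = -1 ∨ n = 0 := by
  cases w with
  | nil => exact h
  | cons x w => exact h.1

theorem inStrip_iff_prefix (w : List (Fin 2 × Bool)) (n : ℤ) :
    InStrip n w ↔ ∀ p : List (Fin 2 × Bool), p <+: w → n + bSum p = -1 ∨ n + bSum p = 0 := by
  induction w generalizing n with
  | nil => simp [InStrip, bSum]
  | cons x w ih =>
    rw [InStrip, ih]
    constructor
    · rintro ⟨hn, h⟩ p hp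
      obtain rfl | ⟨t, rfl, ht⟩ := List.prefix_cons_iff.1 hp
      · simpa [bSum] using hn
      · rw [bSum_cons, ← add_assoc]
        exact h t ht
    · intro h
      refine ⟨by simpa [bSum] using h [] (by simp), fun p hp => ?_⟩
      rw [add_assoc, ← bSum_cons]
      exact h _ (List.cons_prefix_cons.2 ⟨rfl, hp⟩)

theorem InStrip.step {u v : List (Fin 2 × Bool)} (huv : FreeGroup.Red.Step u v) {n : ℤ}
    (h : InStrip n u) : InStrip n v := by
  obtain @⟨L₁, L₂, x, s⟩ := huv
  induction L₁ generalizing n with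
  | nil =>
    have hs : n + bSum [(x, s)] + bSum [(x, !s)] = n := by
      cases s <;> fin_cases x <;> simp [bSum]
    have h₂ := h.2.2
    rwa [hs] at h₂
  | cons y L₁ ih => exact ⟨h.1, ih h.2⟩

theorem InStrip.red {u v : List (Fin 2 × Bool)} (huv : FreeGroup.Red u v) {n : ℤ}
    (h : InStrip n u) : InStrip n v := by
  induction huv with
  | refl => exact h
  | tail _ hs ih => exact ih.step hs

theorem exists_inStrip_of_mem_H {W : F} (hW : W ∈ H) :
    ∃ w, FreeGroup.mk w = W ∧ InStrip 0 w := by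
  induction hW using Subgroup.closure_induction_left with
  | one => exact ⟨[], rfl, by simp [InStrip]⟩
  | mul_left x hx y hy ih =>
    obtain ⟨w, rfl, hw⟩ := ih
    obtain rfl | rfl := hx
    · exact ⟨(0, true) :: w, rfl, by simpa [InStrip, bSum] using hw⟩
    · exact ⟨(1, false) :: (0, true) :: (1, true) :: w, rfl, by simpa [InStrip, bSum] using hw⟩
  | inv_mul_cancel x hx y hy ih =>
    obtain ⟨w, rfl, hw⟩ := ih
    obtain rfl | rfl := hx
    · exact ⟨(0, false) :: w, rfl, by simpa [InStrip, bSum] using hw⟩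
    · exact ⟨(1, false) :: (0, false) :: (1, true) :: w, rfl, by simpa [InStrip, bSum] using hw⟩

theorem a_mem_H : a ∈ H := Subgroup.subset_closure (by simp)

theorem conj_a_mem_H : b⁻¹ * a * b ∈ H := Subgroup.subset_closure (by simp)

theorem zpow_mul_mk_mem_H (w : List (Fin 2 × Bool)) (n : ℤ) (h : InStrip n w)
    (hn : n + bSum w = 0) : b ^ n * FreeGroup.mk w ∈ H := by
  induction w generalizing n with
  | nil =>
    obtain rfl : n = 0 := by simpa [bSum] using hn
    simp [← FreeGroup.one_eq_mk]
  | cons x w ih =>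
    have hw := ih _ h.2 (by rw [add_assoc, ← bSum_cons, hn])
    obtain ⟨i, s⟩ := x
    have hmk : FreeGroup.mk ((i, s) :: w) = FreeGroup.mk [(i, s)] * FreeGroup.mk w := by simp
    rw [hmk]
    fin_cases i
    · have hx : ∃ e : ℤ, FreeGroup.mk [((0 : Fin 2), s)] = a ^ e := by
        cases s
        · exact ⟨-1, by rw [zpow_neg_one]; rfl⟩
        · exact ⟨1, by rw [zpow_one]; rfl⟩
      obtain ⟨e, he⟩ := hx
      have hw' : b ^ n * FreeGroup.mk w ∈ H := by simpa [bSum] using hw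
      have hc : b ^ n * a ^ e * (b ^ n)⁻¹ ∈ H := by
        rw [← conj_zpow]
        refine H.zpow_mem ?_ e
        obtain rfl | rfl := h.start
        · simpa using conj_a_mem_H
        · simpa using a_mem_H
      simpa [he, mul_assoc] using H.mul_mem hc hw'
    · have hx : FreeGroup.mk [((1 : Fin 2), s)] = b ^ bSum [(1, s)] := by
        cases s
        · simp only [bSum]; exact (zpow_neg_one b).symm
        · simp only [bSum]; exact (zpow_one b).symm
      have hw' := hw
      rw [zpow_add] at hw'
      simpa [hx, mul_assoc] using hw'

/-- An element `W` of `F(a,b)` whose `b`-exponent sum is zero lies in `⟨a, b⁻¹ab⟩`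
if and only if every prefix of its reduced word has `b`-exponent sum `-1` or `0`. -/
theorem mem_H_iff_prefix_bSum (W : F) (h0 : bSum W.toWord = 0) :
    W ∈ H ↔ ∀ p : List (Fin 2 × Bool), p <+: W.toWord → bSum p = -1 ∨ bSum p = 0 := by
  have hiff := inStrip_iff_prefix W.toWord 0
  simp only [zero_add] at hiff
  rw [← hiff]
  constructor
  · intro hW
    obtain ⟨w, rfl, hw⟩ := exists_inStrip_of_mem_H hW
    rw [FreeGroup.toWord_mk]
    exact hw.red FreeGroup.reduce.red
  · intro h
    simpa [FreeGroup.mk_toWord] using zpow_mul_mk_mem_H W.toWord 0 h (by rw [h0, zero_add])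
end
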